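/- Let N be a symbolically compact high-level Petri net (N ∈ Nsc) and let ≺ be an adequate order on the finite configurations of its symbolic unfolding Υ satisfying |C1| < |C2| ⇒ C1 ≺ C2. Let Fin be the prefix of Υ consisting of all events e such that the cone [e] contains no cut-off* event of Υ other than possibly e itself, together with all conditions in B0 and in the postsets of these events. Then Fin is a finite and complete prefix of Υ(N). -/

import Mathlib

/-
Core formalization of high-level Petri nets, symbolic unfoldings,
branching processes, configurations, adequate orders, cut-off events,
expansions and constraints, following Würdemann–Chatain–Haar–Panneke,
"Taking Complete Finite Prefixes To High Level, Symbolically".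
-/

noncomputable section
open scoped Classical

/-- A high-level Petri net over a set `Color` of colors and a set `Var` of variables:
places, transitions, a flow function (given by the multisets of `(place, variable)`
pairs on the input resp. output arcs of each transition), a guard for each transition
(a predicate on the assignments of colors to variables), and a set of initial markings. -/
structure HLNet (Color : Type) (Var : Type) : Type 1 where
  Place : Type
  Trans : Type
  preFlow : Trans → Multiset (Place × Var)
  postFlow : Trans → Multiset (Place × Var)
  guard : Trans → (Var → Color) → Prop
  init : Set (Multiset (Place × Color))

namespace HLNet

variable {Color Var : Type}

/-- A marking: a multiset over `Place × Color`. -/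
abbrev Marking (N : HLNet Color Var) : Type := Multiset (N.Place × Color)

/-- Well-formedness: the set of initial markings is nonempty, and all initial markings
mark the same places with the same numbers of colors. -/
def WellFormed (N : HLNet Color Var) : Prop :=
  N.init.Nonempty ∧
    ∀ M ∈ N.init, ∀ M' ∈ N.init, Multiset.map Prod.fst M = Multiset.map Prod.fst M'

/-- The net is finite: finitely many places and transitions
(the support of the flow function is then automatically finite). -/
def NetFinite (N : HLNet Color Var) : Prop := Finite N.Place ∧ Finite N.Trans

/-- The guards are written in a decidable theory (stand-in: each guard is a
decidable predicate on modes). -/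
def DecidableGuards (N : HLNet Color Var) : Prop :=
  ∀ t σ, Nonempty (Decidable (N.guard t σ))

/-- `•(t,σ)`, the multiset of colored tokens consumed by transition `t` fired in mode `σ`. -/
def preMark (N : HLNet Color Var) (t : N.Trans) (σ : Var → Color) : N.Marking :=
  (N.preFlow t).map fun pv => (pv.1, σ pv.2)

/-- `(t,σ)•`, the multiset of colored tokens produced by transition `t` fired in mode `σ`. -/
def postMark (N : HLNet Color Var) (t : N.Trans) (σ : Var → Color) : N.Marking :=
  (N.postFlow t).map fun pv => (pv.1, σ pv.2)

/-- `M[t,σ⟩`: transition `t` can fire in mode `σ` from marking `M`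
(`σ` is a mode of `t`, i.e. the guard holds, and `•(t,σ) ≤ M`). -/
def fires (N : HLNet Color Var) (M : N.Marking) (t : N.Trans) (σ : Var → Color) : Prop :=
  N.guard t σ ∧ N.preMark t σ ≤ M

/-- `M[t,σ⟩M'`: firing `t` in mode `σ` from `M` yields `M'`. -/
def firesTo (N : HLNet Color Var) (M : N.Marking) (t : N.Trans) (σ : Var → Color)
    (M' : N.Marking) : Prop :=
  N.fires M t σ ∧ M' = (M - N.preMark t σ) + N.postMark t σ

/-- `R(N)`: the markings reachable from some initial marking by finitely many firings. -/
inductive Reach (N : HLNet Color Var) : N.Marking → Prop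
  | init {M : N.Marking} : M ∈ N.init → Reach N M
  | step {M : N.Marking} {t : N.Trans} {σ : Var → Color} {M' : N.Marking} :
      Reach N M → N.firesTo M t σ M' → Reach N M'

/-- The markings reachable in exactly `n` firings. -/
def ReachSteps (N : HLNet Color Var) : ℕ → N.Marking → Prop
  | 0, M => M ∈ N.init
  | n + 1, M' => ∃ M t σ, ReachSteps N n M ∧ N.firesTo M t σ M'

/-- Every reachable marking is reachable by firing at most `n` transitions. -/
def BoundedReach (N : HLNet Color Var) (n : ℕ) : Prop :=
  ∀ M, N.Reach M → ∃ k ≤ n, N.ReachSteps k M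

/-- Safety: in every reachable marking every place holds at most one color. -/
def Safe (N : HLNet Color Var) : Prop :=
  ∀ M, N.Reach M → ∀ p : N.Place, (M.filter fun pc => pc.1 = p).card ≤ 1

/-- Nodes of the net: places and transitions. -/
abbrev Node (N : HLNet Color Var) : Type := N.Place ⊕ N.Trans

/-- The arc relation `x → y` between nodes. -/
def arc (N : HLNet Color Var) : N.Node → N.Node → Prop
  | Sum.inl b, Sum.inr t => ∃ v, (b, v) ∈ N.preFlow t
  | Sum.inr t, Sum.inl b => ∃ v, (b, v) ∈ N.postFlow t
  | Sum.inl _, Sum.inl _ => False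
  | Sum.inr _, Sum.inr _ => False

/-- The causality relation `<` (irreflexive transitive closure of the arc relation). -/
def clt (N : HLNet Color Var) : N.Node → N.Node → Prop := Relation.TransGen N.arc

/-- The causality relation `≤` (reflexive transitive closure of the arc relation). -/
def cle (N : HLNet Color Var) : N.Node → N.Node → Prop := Relation.ReflTransGen N.arc

/-- `<` on transitions/events. -/
def evLT (N : HLNet Color Var) (e e' : N.Trans) : Prop := N.clt (Sum.inr e) (Sum.inr e')

/-- `≤` on transitions/events. -/
def evLE (N : HLNet Color Var) (e e' : N.Trans) : Prop := N.cle (Sum.inr e) (Sum.inr e')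

/-- Structural conflict `x ♯ y`: distinct transitions sharing an input place
causally precede `x` and `y` respectively. -/
def SConflict (N : HLNet Color Var) (x y : N.Node) : Prop :=
  ∃ (b : N.Place) (t1 t2 : N.Trans), t1 ≠ t2 ∧
    (∃ v, (b, v) ∈ N.preFlow t1) ∧ (∃ v, (b, v) ∈ N.preFlow t2) ∧
    N.cle (Sum.inr t1) x ∧ N.cle (Sum.inr t2) y

/-- Ordinariness: at most one arc connects any two nodes. -/
def Ordinary (N : HLNet Color Var) : Prop :=
  (∀ (t : N.Trans) (b : N.Place), ((N.preFlow t).filter fun pv => pv.1 = b).card ≤ 1) ∧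
  (∀ (t : N.Trans) (b : N.Place), ((N.postFlow t).filter fun pv => pv.1 = b).card ≤ 1)

/-- A high-level occurrence net: an ordinary well-formed high-level Petri net
(places = conditions, transitions = events) such that no event is in structural
self-conflict, no node is its own causal predecessor, causality is well-founded,
and each condition either has no incoming arc and is marked with exactly one color
in all initial cuts, or has a unique incoming arc and is unmarked in all initial cuts. -/
def IsOccNet (O : HLNet Color Var) : Prop :=
  O.WellFormed ∧ O.Ordinary ∧
  (∀ e : O.Trans, ¬ O.SConflict (Sum.inr e) (Sum.inr e)) ∧
  (∀ x : O.Node, ¬ O.clt x x) ∧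
  WellFounded O.clt ∧
  (∀ b : O.Place,
    ((∀ (e : O.Trans) (v : Var), (b, v) ∉ O.postFlow e) ∧
      ∀ K ∈ O.init, (K.filter fun bc => bc.1 = b).card = 1) ∨
    ((∃ (e : O.Trans) (v : Var), (b, v) ∈ O.postFlow e ∧
        ∀ (e' : O.Trans) (v' : Var), (b, v') ∈ O.postFlow e' → e' = e ∧ v' = v) ∧
      ∀ K ∈ O.init, (K.filter fun bc => bc.1 = b).card = 0))

/-- `•b = (e(b), v(b))`: the unique input event and arc-variable of a condition,
or `none` for the `⊥`-conditions (the conditions marked in all initial cuts). -/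
def condPre (O : HLNet Color Var) (b : O.Place) : Option (O.Trans × Var) :=
  if h : ∃ ev : O.Trans × Var, (b, ev.2) ∈ O.postFlow ev.1 then some h.choose else none

/-- An assignment of colors to the indexed variables: the variables `v_e` for events `e`
(`Sum.inl (e, v)`), and the variables `v^b_⊥` for conditions `b` (`Sum.inr b`). -/
abbrev Assign (O : HLNet Color Var) : Type := ((O.Trans × Var) ⊕ O.Place) → Color

/-- The color placed on condition `b` under assignment `ι`:
the value of `v(b)_{e(b)}`, resp. `v^b_⊥`. -/
def valOf (O : HLNet Color Var) (ι : O.Assign) (b : O.Place) : Color :=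
  match O.condPre b with
  | none => ι (Sum.inr b)
  | some ev => ι (Sum.inl ev)

/-- `pred(⊥)`: `ι` chooses one of the initial cuts. -/
def predBot (O : HLNet Color Var) (ι : O.Assign) : Prop :=
  ∃ K ∈ O.init, ∀ (b : O.Place) (c : Color), (b, c) ∈ K → ι (Sum.inr b) = c

/-- `loc(e)`: the local predicate of an event. -/
def locPred (O : HLNet Color Var) (e : O.Trans) (ι : O.Assign) : Prop :=
  O.guard e (fun v => ι (Sum.inl (e, v))) ∧
  ∀ bv ∈ O.preFlow e, ι (Sum.inl (e, bv.2)) = O.valOf ι bv.1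

/-- `pred(e) = pred(⊥) ∧ ⋀_{e' ≤ e} loc(e')`. -/
def pred (O : HLNet Color Var) (e : O.Trans) (ι : O.Assign) : Prop :=
  O.predBot ι ∧ ∀ e', O.evLE e' e → O.locPred e' ι

/-- `pred(e(b))` for a condition `b` (which is `pred(⊥)` for `⊥`-conditions). -/
def condPred (O : HLNet Color Var) (b : O.Place) (ι : O.Assign) : Prop :=
  match O.condPre b with
  | none => O.predBot ι
  | some ev => O.pred ev.1 ι

/-- An instantiation of a set `C` of events: an assignment satisfying `pred(e)` for
every `e ∈ C ∪ {⊥}`. -/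
def IsInst (O : HLNet Color Var) (C : Set O.Trans) (ι : O.Assign) : Prop :=
  O.predBot ι ∧ ∀ e ∈ C, O.pred e ι

/-- A configuration: a causally closed set of events free of structural conflict
and of color conflict. -/
def IsConfig (O : HLNet Color Var) (C : Set O.Trans) : Prop :=
  (∀ e ∈ C, ∀ e', O.evLE e' e → e' ∈ C) ∧
  (∀ e ∈ C, ∀ e' ∈ C, ¬ O.SConflict (Sum.inr e) (Sum.inr e')) ∧
  ∃ ι, O.IsInst C ι

/-- A finite configuration. -/
def FinCfg (O : HLNet Color Var) (C : Set O.Trans) : Prop := O.IsConfig C ∧ C.Finite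

/-- The cone configuration `[e] = {e' : e' ≤ e}` of an event. -/
def cone (O : HLNet Color Var) (e : O.Trans) : Set O.Trans := {e' | O.evLE e' e}

/-- `B0`: the conditions marked in all initial cuts (those with `•b = (⊥, v^b)`). -/
def B0 (O : HLNet Color Var) : Set O.Place := {b | O.condPre b = none}

/-- `C→`: the conditions in the postsets of the events of `C`. -/
def postConds (O : HLNet Color Var) (C : Set O.Trans) : Set O.Place :=
  {b | ∃ e ∈ C, ∃ v, (b, v) ∈ O.postFlow e}

/-- `→C`: the conditions in the presets of the events of `C`. -/
def preConds (O : HLNet Color Var) (C : Set O.Trans) : Set O.Place :=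
  {b | ∃ e ∈ C, ∃ v, (b, v) ∈ O.preFlow e}

/-- `Cut(C) = (B0 ∪ C→) \ →C`. -/
def cut (O : HLNet Color Var) (C : Set O.Trans) : Set O.Place :=
  (O.B0 ∪ O.postConds C) \ O.preConds C

/-- `Cut(C, ι)` as a marking of the occurrence net (requires `Cut(C)` to be finite). -/
def cutMark (O : HLNet Color Var) {C : Set O.Trans} (hfin : (O.cut C).Finite)
    (ι : O.Assign) : O.Marking :=
  hfin.toFinset.val.map fun b => (b, O.valOf ι b)

/-- `Cut(C, ι) = {(b, ι(v(b)_{e(b)})) : b ∈ Cut(C)}` as a set. -/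
def cutSet (O : HLNet Color Var) (C : Set O.Trans) (ι : O.Assign) : Set (O.Place × Color) :=
  {bc | bc.1 ∈ O.cut C ∧ bc.2 = O.valOf ι bc.1}

/-- `Cuts(C) = {Cut(C,ι) : ι ∈ I(C)}`. -/
def cuts (O : HLNet Color Var) (C : Set O.Trans) : Set (Set (O.Place × Color)) :=
  {K | ∃ ι, O.IsInst C ι ∧ K = O.cutSet C ι}

/-- `Cuts(C)` as a set of markings of the occurrence net. -/
def cutMarks (O : HLNet Color Var) (C : Set O.Trans) : Set O.Marking :=
  {K | ∃ ι, O.IsInst C ι ∧ ∃ hfin : (O.cut C).Finite, K = O.cutMark hfin ι}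

/-- A homomorphism of high-level nets: maps places to places and transitions to
transitions, preserving guards and the presets and postsets of transitions. -/
structure Hom (O N : HLNet Color Var) where
  mapP : O.Place → N.Place
  mapT : O.Trans → N.Trans
  guard_iff : ∀ (e : O.Trans) (σ : Var → Color), O.guard e σ ↔ N.guard (mapT e) σ
  pre_eq : ∀ e : O.Trans, N.preFlow (mapT e) = (O.preFlow e).map fun bv => (mapP bv.1, bv.2)
  post_eq : ∀ e : O.Trans, N.postFlow (mapT e) = (O.postFlow e).map fun bv => (mapP bv.1, bv.2)

/-- The image of a marking under a homomorphism. -/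
def Hom.mapMarking {O N : HLNet Color Var} (φ : Hom O N) (M : O.Marking) : N.Marking :=
  M.map fun bc => (φ.mapP bc.1, bc.2)

/-- An initial homomorphism: it maps the initial markings onto the initial markings. -/
def Hom.Initial {O N : HLNet Color Var} (φ : Hom O N) : Prop :=
  φ.mapMarking '' O.init = N.init

/-- `Mark(C, ι)`: the marking of `N` represented by the cut of an instantiated
configuration. -/
def mark {O N : HLNet Color Var} (h : Hom O N) {C : Set O.Trans}
    (hfin : (O.cut C).Finite) (ι : O.Assign) : N.Marking :=
  hfin.toFinset.val.map fun b => (h.mapP b, O.valOf ι b)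

/-- `Marks(C) = {Mark(C,ι) : ι ∈ I(C)}`. -/
def marks {O N : HLNet Color Var} (h : Hom O N) (C : Set O.Trans) : Set N.Marking :=
  {M | ∃ ι, O.IsInst C ι ∧ ∃ hfin : (O.cut C).Finite, M = mark h hfin ι}

/-- `(O, h)` is a symbolic branching process of `N`: `O` is an occurrence net all of
whose event predicates are satisfiable, and `h` is an initial homomorphism that is
injective on events with the same preset. -/
def IsSBP {O N : HLNet Color Var} (h : Hom O N) : Prop :=
  O.IsOccNet ∧ h.Initial ∧ (∀ e : O.Trans, ∃ ι, O.pred e ι) ∧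
  ∀ e e' : O.Trans, O.preFlow e = O.preFlow e' → h.mapT e = h.mapT e' → e = e'

/-- `(O1, h1)` is a prefix of `(O2, h2)`: there is an injective initial homomorphism
`φ : O1 → O2` with `h2 ∘ φ = h1`. -/
def IsPrefix {O1 O2 N : HLNet Color Var} (h1 : Hom O1 N) (h2 : Hom O2 N) : Prop :=
  ∃ φ : Hom O1 O2, φ.Initial ∧ Function.Injective φ.mapP ∧ Function.Injective φ.mapT ∧
    (∀ b, h2.mapP (φ.mapP b) = h1.mapP b) ∧ ∀ e, h2.mapT (φ.mapT e) = h1.mapT e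

/-- `(O, h)` is the symbolic unfolding `Υ(N)` of `N`: the (unique up to isomorphism)
maximal symbolic branching process of `N`. -/
def IsUnfolding {O N : HLNet Color Var} (h : Hom O N) : Prop :=
  IsSBP h ∧ ∀ (O' : HLNet Color Var) (h' : Hom O' N), IsSBP h' → IsPrefix h' h

/-- The net `N` with its set of initial markings replaced by `I`. -/
def withInit (N : HLNet Color Var) (I : Set N.Marking) : HLNet Color Var :=
  { N with init := I }

/-- Restriction of a marking to a subset of the places. -/
def restrictMark (O : HLNet Color Var) (SP : Set O.Place) (M : O.Marking) :
    Multiset (↥SP × Color) :=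
  M.filterMap fun bc => if h : bc.1 ∈ SP then some (⟨bc.1, h⟩, bc.2) else none

/-- The subnet of `O` on the places `SP` and transitions `ST`, with initial markings `I`. -/
def restrict (O : HLNet Color Var) (SP : Set O.Place) (ST : Set O.Trans)
    (I : Set (Multiset (↥SP × Color))) : HLNet Color Var where
  Place := ↥SP
  Trans := ↥ST
  preFlow e := (O.preFlow e.1).filterMap fun bv =>
    if h : bv.1 ∈ SP then some (⟨bv.1, h⟩, bv.2) else none
  postFlow e := (O.postFlow e.1).filterMap fun bv =>
    if h : bv.1 ∈ SP then some (⟨bv.1, h⟩, bv.2) else none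
  guard e σ := O.guard e.1 σ
  init := I

/-- The predicate contributed by a node to a color conflict:
`pred(e)` for an event `e`, `pred(e(b))` for a condition `b`. -/
def nodePred (O : HLNet Color Var) (x : O.Node) (ι : O.Assign) : Prop :=
  match x with
  | Sum.inl b => O.condPred b ι
  | Sum.inr e => O.pred e ι

/-- The nodes of the future `↑C`: nodes not in `C ∪ →C`, not in structural conflict
with any event of `C`, and not in color conflict together with `C`. -/
def futureNode (O : HLNet Color Var) (C : Set O.Trans) (x : O.Node) : Prop :=
  (match x with
   | Sum.inl b => b ∉ O.preConds C
   | Sum.inr e => e ∉ C) ∧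
  (∀ e' ∈ C, ¬ O.SConflict (Sum.inr e') x) ∧
  ∃ ι, O.IsInst C ι ∧ O.nodePred x ι

def futurePlaces (O : HLNet Color Var) (C : Set O.Trans) : Set O.Place :=
  {b | O.futureNode C (Sum.inl b)}

def futureEvents (O : HLNet Color Var) (C : Set O.Trans) : Set O.Trans :=
  {e | O.futureNode C (Sum.inr e)}

/-- The underlying net of the future `↑C` of a configuration `C`, with the cuts of `C`
as initial cuts. -/
def future (O : HLNet Color Var) (C : Set O.Trans) : HLNet Color Var :=
  O.restrict (O.futurePlaces C) (O.futureEvents C)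
    (O.restrictMark (O.futurePlaces C) '' O.cutMarks C)

def futPVal (O : HLNet Color Var) (C : Set O.Trans) : (O.future C).Place → O.Place :=
  fun b => b.1

def futTVal (O : HLNet Color Var) (C : Set O.Trans) : (O.future C).Trans → O.Trans :=
  fun e => e.1

/-- The conditions of the occurrence net `O(C|D)`: `Cut(C) ∪ →D ∪ D→`. -/
def aroundPlaces (O : HLNet Color Var) (C D : Set O.Trans) : Set O.Place :=
  O.cut C ∪ O.preConds D ∪ O.postConds D

/-- The occurrence net `O(C|D)` "around `D` from `Cut(C)`", with initial cuts `Cuts(C)`. -/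
def around (O : HLNet Color Var) (C D : Set O.Trans) : HLNet Color Var :=
  O.restrict (O.aroundPlaces C D) D
    (O.restrictMark (O.aroundPlaces C D) '' O.cutMarks C)

def arPVal (O : HLNet Color Var) (C D : Set O.Trans) : (O.around C D).Place → O.Place :=
  fun b => b.1

def arTVal (O : HLNet Color Var) (C D : Set O.Trans) : (O.around C D).Trans → O.Trans :=
  fun e => e.1

/-- `D` is a suffix of `C`, i.e. `C ⊕ D` is defined: `C` and `D` are disjoint and
`C ∪ D` is a configuration. -/
def IsSuffix (O : HLNet Color Var) (C D : Set O.Trans) : Prop :=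
  Disjoint C D ∧ O.IsConfig (C ∪ D)

/-- `C⟦M⟧D`: some instantiation of `C ⊕ D`, restricted to the variables of `C ∪ {⊥}`,
yields the marking `M` for `C`. -/
def markRel {O N : HLNet Color Var} (h : Hom O N) (C : Set O.Trans) (M : N.Marking)
    (D : Set O.Trans) : Prop :=
  ∃ ι, O.IsInst (C ∪ D) ι ∧ ∃ hfin : (O.cut C).Finite, mark h hfin ι = M

/-- `φ` is a monomorphism `O(C1|D) → ↑C2` preserving the labeling and mapping
`Cut(C1)` onto `Cut(C2)`. -/
def IsCanonMono {O N : HLNet Color Var} (h : Hom O N) (C1 D C2 : Set O.Trans)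
    (φ : Hom (O.around C1 D) (O.future C2)) : Prop :=
  Function.Injective φ.mapP ∧ Function.Injective φ.mapT ∧
  (∀ b, h.mapP (O.futPVal C2 (φ.mapP b)) = h.mapP (O.arPVal C1 D b)) ∧
  (∀ e, h.mapT (O.futTVal C2 (φ.mapT e)) = h.mapT (O.arTVal C1 D e)) ∧
  (fun b => O.futPVal C2 (φ.mapP b)) '' {b | O.arPVal C1 D b ∈ O.cut C1} = O.cut C2

/-- `φ(D)`: the image of the events `D` of `O(C1|D)` under `φ`, as a set of events of `O`. -/
def monoImageD {O : HLNet Color Var} (C1 D C2 : Set O.Trans)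
    (φ : Hom (O.around C1 D) (O.future C2)) : Set O.Trans :=
  {e | ∃ d, O.futTVal C2 (φ.mapT d) = e}

/-- An adequate order on the finite configurations of a symbolic branching process
`(O, h)`: a well-founded strict partial order refining set inclusion and preserved
by finite extensions (via the canonical monomorphism between the futures). -/
def IsAdequate {O N : HLNet Color Var} (h : Hom O N)
    (r : Set O.Trans → Set O.Trans → Prop) : Prop :=
  (∀ C, O.FinCfg C → ¬ r C C) ∧
  (∀ C1 C2 C3, O.FinCfg C1 → O.FinCfg C2 → O.FinCfg C3 → r C1 C2 → r C2 C3 → r C1 C3) ∧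
  WellFounded (fun a b : {C : Set O.Trans // O.FinCfg C} => r a.1 b.1) ∧
  (∀ C1 C2, O.FinCfg C1 → O.FinCfg C2 → C1 ⊂ C2 → r C1 C2) ∧
  (∀ C1 C2 D M, O.FinCfg C1 → O.FinCfg C2 → O.IsSuffix C1 D → D.Finite →
    M ∈ marks h C1 → M ∈ marks h C2 → markRel h C1 M D →
    ∀ φ : Hom (O.around C1 D) (O.future C2), IsCanonMono h C1 D C2 φ →
      r C1 C2 → r (C1 ∪ D) (C2 ∪ monoImageD C1 D C2 φ))

/-- A cut-off event: every marking of its cone configuration is represented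
by the cone configuration of a `≺`-smaller event. -/
def IsCutoff {O N : HLNet Color Var} (h : Hom O N)
    (r : Set O.Trans → Set O.Trans → Prop) (e : O.Trans) : Prop :=
  ∀ M ∈ marks h (O.cone e), ∃ e', r (O.cone e') (O.cone e) ∧ M ∈ marks h (O.cone e')

/-- A cut-off* event: every marking of its cone configuration is represented
by some `≺`-smaller finite configuration. -/
def IsCutoffStar {O N : HLNet Color Var} (h : Hom O N)
    (r : Set O.Trans → Set O.Trans → Prop) (e : O.Trans) : Prop :=
  ∀ M ∈ marks h (O.cone e), ∃ C, O.FinCfg C ∧ r C (O.cone e) ∧ M ∈ marks h C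

/-- The events of the prefix `Fin`: events whose cone contains no cut-off event other
than possibly the event itself. -/
def finEvents {O N : HLNet Color Var} (h : Hom O N)
    (r : Set O.Trans → Set O.Trans → Prop) : Set O.Trans :=
  {e | ∀ e' ∈ O.cone e, e' ≠ e → ¬ IsCutoff h r e'}

/-- The conditions of the prefix `Fin`: the conditions of `B0` and those in the
postsets of the events of `Fin`. -/
def finConds {O N : HLNet Color Var} (h : Hom O N)
    (r : Set O.Trans → Set O.Trans → Prop) : Set O.Place :=
  O.B0 ∪ {b | ∃ e ∈ finEvents h r, ∃ v, (b, v) ∈ O.postFlow e}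

/-- The events of the prefix `Fin` for the cut-off* criterion. -/
def finEventsStar {O N : HLNet Color Var} (h : Hom O N)
    (r : Set O.Trans → Set O.Trans → Prop) : Set O.Trans :=
  {e | ∀ e' ∈ O.cone e, e' ≠ e → ¬ IsCutoffStar h r e'}

/-- The conditions of the prefix `Fin` for the cut-off* criterion. -/
def finCondsStar {O N : HLNet Color Var} (h : Hom O N)
    (r : Set O.Trans → Set O.Trans → Prop) : Set O.Place :=
  O.B0 ∪ {b | ∃ e ∈ finEventsStar h r, ∃ v, (b, v) ∈ O.postFlow e}

/-- Completeness of the sub-branching-process of `(O,h)` on the events `E'`: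
every reachable marking `M` of `N` is `Mark(C,ι)` for a configuration `C ⊆ E'` and
an instantiation `ι ∈ I(C)` such that moreover every transition/mode firable from `M`
is matched by an event of `E'` firable from `Cut(C,ι)`. -/
def CompleteSub {O N : HLNet Color Var} (h : Hom O N) (E' : Set O.Trans) : Prop :=
  ∀ M, N.Reach M → ∃ C, O.IsConfig C ∧ C ⊆ E' ∧ ∃ ι, O.IsInst C ι ∧
    ∃ hfin : (O.cut C).Finite, M = mark h hfin ι ∧
      ∀ (t : N.Trans) (σ : Var → Color), N.fires M t σ →
        ∃ e ∈ E', h.mapT e = t ∧ O.fires (O.cutMark hfin ι) e σ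

/-- Completeness of the branching process `(O, h)`. -/
def Complete {O N : HLNet Color Var} (h : Hom O N) : Prop := CompleteSub h Set.univ

/-- The class `Nf`: finite safe high-level Petri nets with decidable guards and
finitely many reachable markings. -/
def InNf (N : HLNet Color Var) : Prop :=
  N.NetFinite ∧ N.WellFormed ∧ N.Safe ∧ N.DecidableGuards ∧ {M | N.Reach M}.Finite

/-- The class `Nsc` of symbolically compact nets: finite safe high-level Petri nets
with decidable guards admitting a bound on the number of transition firings needed
to reach every reachable marking. -/
def InNsc (N : HLNet Color Var) : Prop :=
  N.NetFinite ∧ N.WellFormed ∧ N.Safe ∧ N.DecidableGuards ∧ ∃ n, N.BoundedReach n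

/-- The modes of a transition. -/
def Mode (N : HLNet Color Var) (t : N.Trans) : Type := {σ : Var → Color // N.guard t σ}

/-- The expansion `Exp(N)`: the P/T Petri net (a high-level net over the trivial sets
of colors and variables) with places `p.c` and transitions `t.σ`. -/
def expand (N : HLNet Color Var) : HLNet Unit Unit where
  Place := N.Place × Color
  Trans := (t : N.Trans) × N.Mode t
  preFlow tσ := (N.preMark tσ.1 tσ.2.1).map fun pc => (pc, ())
  postFlow tσ := (N.postMark tσ.1 tσ.2.1).map fun pc => (pc, ())
  guard _ _ := True
  init := (fun M : N.Marking => M.map fun pc => (pc, ())) '' N.init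

def expPlaceBase (N : HLNet Color Var) : N.expand.Place → N.Place := fun pc => pc.1
def expPlaceColor (N : HLNet Color Var) : N.expand.Place → Color := fun pc => pc.2
def expTransBase (N : HLNet Color Var) : N.expand.Trans → N.Trans := fun tσ => tσ.1
def expTransMode (N : HLNet Color Var) (tσ : N.expand.Trans) : Var → Color := tσ.2.1

/-- The constraint `constr(B')` on a co-set `B'` of conditions, evaluated on an
assignment `a` of colors to the labels `π(B')` (predb(b) for all `b ∈ B'`,
with all bound indexed variables existentially quantified at once). -/
def constrSat {O N : HLNet Color Var} (h : Hom O N) (B' : Set O.Place)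
    (a : N.Place → Color) : Prop :=
  ∃ ι : O.Assign, ∀ b ∈ B', O.condPred b ι ∧ a (h.mapP b) = O.valOf ι b

/-- `φ(E')`: the multiset of the transition labels of a finite set of events. -/
def labelMS {O N : HLNet Color Var} (h : Hom O N) (S : Set O.Trans) : Multiset N.Trans :=
  if hfin : S.Finite then hfin.toFinset.val.map h.mapT else 0

/-- Lexicographic comparison of the `≪`-sorted sequences of two multisets. -/
def msLex {α : Type} (lo : LinearOrder α) (s1 s2 : Multiset α) : Prop :=
  letI := lo
  List.Lex (· < ·) (s1.sort (· ≤ ·)) (s2.sort (· ≤ ·))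

/-- `Min(S)`: the causally minimal events of `S`. -/
def minOf (O : HLNet Color Var) (S : Set O.Trans) : Set O.Trans :=
  {e | e ∈ S ∧ ∀ e' ∈ S, ¬ O.evLT e' e}

/-- What remains of `C` after removing the first `n` blocks of its Foata normal form. -/
def foataResidual (O : HLNet Color Var) (C : Set O.Trans) : ℕ → Set O.Trans
  | 0 => C
  | n + 1 => foataResidual O C n \ O.minOf (foataResidual O C n)

/-- The `n`-th block of the Foata normal form of `C`. -/
def foataBlock (O : HLNet Color Var) (C : Set O.Trans) (n : ℕ) : Set O.Trans :=
  O.minOf (O.foataResidual C n)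

/-- `FC1 ≪ FC2`: comparison of Foata normal forms. -/
def foataLex {O N : HLNet Color Var} (h : Hom O N) (lo : LinearOrder N.Trans)
    (C1 C2 : Set O.Trans) : Prop :=
  ∃ i : ℕ, (∀ j < i, labelMS h (O.foataBlock C1 j) = labelMS h (O.foataBlock C2 j)) ∧
    msLex lo (labelMS h (O.foataBlock C1 i)) (labelMS h (O.foataBlock C2 i))

/-- McMillan's order `≺_M`: comparison by size. -/
def rM {O : HLNet Color Var} (C1 C2 : Set O.Trans) : Prop := C1.ncard < C2.ncard

/-- The order `≺_E`: by size, then lexicographically on sorted label sequences. -/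
def rE {O N : HLNet Color Var} (h : Hom O N) (lo : LinearOrder N.Trans)
    (C1 C2 : Set O.Trans) : Prop :=
  C1.ncard < C2.ncard ∨
    (C1.ncard = C2.ncard ∧ msLex lo (labelMS h C1) (labelMS h C2))

/-- The total order `≺_F`: by size, then lexicographically on sorted label sequences,
then by Foata normal forms. -/
def rF {O N : HLNet Color Var} (h : Hom O N) (lo : LinearOrder N.Trans)
    (C1 C2 : Set O.Trans) : Prop :=
  C1.ncard < C2.ncard ∨
    (C1.ncard = C2.ncard ∧ msLex lo (labelMS h C1) (labelMS h C2)) ∨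
    (labelMS h C1 = labelMS h C2 ∧ foataLex h lo C1 C2)

end HLNet

namespace HLNet

variable {Color Var : Type}

section Multisets

variable {α β γ κ : Type}

/-- Two multisets with equal images are related by a matching map, which may be taken to
factor through any key that is injective on the first one. -/
theorem exists_matching_of_map_eq (f₀ : κ → β) (k : α → κ) (F : α → γ) (G : β → γ)
    (s : Multiset α) : ∀ t : Multiset β, (s.map k).Nodup → s.map F = t.map G →
      ∃ f : κ → β, t = s.map (fun a => f (k a)) ∧ ∀ a ∈ s, G (f (k a)) = F a := by
  induction s using Multiset.induction_on with
  | empty =>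
    intro t _ ht
    exact ⟨f₀, by simpa using ht.symm, by simp⟩
  | cons a s ih =>
    intro t hs ht
    rw [Multiset.map_cons, Multiset.nodup_cons] at hs
    rw [Multiset.map_cons] at ht
    obtain ⟨b, hb, hab, ht'⟩ := (Multiset.map_eq_cons G t _ _).mpr ht.symm
    obtain ⟨f, hf, hfF⟩ := ih _ hs.2 ht'.symm
    have hne : ∀ a' ∈ s, k a' ≠ k a := fun a' ha' he =>
      hs.1 (he ▸ Multiset.mem_map_of_mem k ha')
    refine ⟨Function.update f (k a) b, ?_, ?_⟩
    · rw [Multiset.map_cons, Function.update_self, ← Multiset.cons_erase hb, hf]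
      congr 1
      exact Multiset.map_congr rfl fun a' ha' => by rw [Function.update_of_ne (hne a' ha')]
    · intro a' ha'
      rcases Multiset.mem_cons.mp ha' with rfl | ha'
      · rw [Function.update_self, hab]
      · rw [Function.update_of_ne (hne a' ha'), hfF a' ha']

/-- A multiset below the image of another one is the image of a submultiset. -/
theorem exists_le_map_eq (G : β → γ) (s : Multiset γ) (t : Multiset β) (hst : s ≤ t.map G) :
    ∃ u ≤ t, u.map G = s := by
  induction s using Multiset.induction_on generalizing t with
  | empty => exact ⟨0, Multiset.zero_le _, rfl⟩
  | cons c s ih =>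
    obtain ⟨b, hb, rfl⟩ := Multiset.mem_map.mp (Multiset.mem_of_le hst (Multiset.mem_cons_self c s))
    rw [← Multiset.cons_erase hb, Multiset.map_cons, Multiset.cons_le_cons_iff] at hst
    obtain ⟨u, hu, hus⟩ := ih _ hst
    refine ⟨b ::ₘ u, ?_, by rw [Multiset.map_cons, hus]⟩
    rw [← Multiset.cons_erase hb]
    exact Multiset.cons_le_cons b hu

theorem nodup_map_of_card_filter_le_one (k : α → κ) (s : Multiset α)
    (hs : ∀ x, (s.filter fun a => k a = x).card ≤ 1) : (s.map k).Nodup := by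
  rw [Multiset.nodup_iff_count_le_one]
  intro x
  rw [Multiset.count_map]
  simpa [eq_comm] using hs x

theorem map_injOn_of_nodup_map (k : α → κ) (s : Multiset α) (hs : (s.map k).Nodup)
    {a b : α} (ha : a ∈ s) (hb : b ∈ s) (hab : k a = k b) : a = b :=
  Multiset.inj_on_of_nodup_map hs a ha b hb hab

end Multisets

/-- The input conditions of an event. -/
def pre (O : HLNet Color Var) (e : O.Trans) : Set O.Place := {b | ∃ v, (b, v) ∈ O.preFlow e}

/-- The output conditions of an event. -/
def post (O : HLNet Color Var) (e : O.Trans) : Set O.Place := {b | ∃ v, (b, v) ∈ O.postFlow e}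

/-- A causally closed set of events. -/
def Closed (O : HLNet Color Var) (C : Set O.Trans) : Prop := ∀ e ∈ C, ∀ e', O.evLE e' e → e' ∈ C

/-- A set of events free of structural conflict. -/
def ConflictFree (O : HLNet Color Var) (C : Set O.Trans) : Prop :=
  ∀ e ∈ C, ∀ e' ∈ C, ¬ O.SConflict (Sum.inr e) (Sum.inr e')

/-- Every condition has at most one incoming arc. -/
def UniqueInput (O : HLNet Color Var) : Prop :=
  ∀ e v e' v' b, (b, v) ∈ O.postFlow e → (b, v') ∈ O.postFlow e' → e' = e ∧ v' = v

section Basic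

variable {O N : HLNet Color Var}

theorem mem_preConds {C : Set O.Trans} {b : O.Place} : b ∈ O.preConds C ↔ ∃ e ∈ C, b ∈ O.pre e :=
  Iff.rfl

theorem mem_postConds {C : Set O.Trans} {b : O.Place} :
    b ∈ O.postConds C ↔ ∃ e ∈ C, b ∈ O.post e :=
  Iff.rfl

theorem preConds_insert (C : Set O.Trans) (e : O.Trans) :
    O.preConds (insert e C) = O.pre e ∪ O.preConds C := by
  ext b
  simp [mem_preConds]

theorem postConds_insert (C : Set O.Trans) (e : O.Trans) :
    O.postConds (insert e C) = O.post e ∪ O.postConds C := by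
  ext b
  simp [mem_postConds]

theorem pre_finite (e : O.Trans) : (O.pre e).Finite := by
  refine ((O.preFlow e).map Prod.fst).toFinset.finite_toSet.subset ?_
  rintro b ⟨v, hb⟩
  simpa using ⟨v, hb⟩

theorem post_finite (e : O.Trans) : (O.post e).Finite := by
  refine ((O.postFlow e).map Prod.fst).toFinset.finite_toSet.subset ?_
  rintro b ⟨v, hb⟩
  simpa using ⟨v, hb⟩

theorem postConds_finite {C : Set O.Trans} (hC : C.Finite) : (O.postConds C).Finite := by
  have : O.postConds C = ⋃ e ∈ C, O.post e := by
    ext b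
    simp [mem_postConds]
  rw [this]
  exact hC.biUnion fun e _ => post_finite e

theorem evLE_refl (e : O.Trans) : O.evLE e e := Relation.ReflTransGen.refl

theorem evLE_trans {e₁ e₂ e₃ : O.Trans} (h₁ : O.evLE e₁ e₂) (h₂ : O.evLE e₂ e₃) : O.evLE e₁ e₃ :=
  Relation.ReflTransGen.trans h₁ h₂

theorem evLE_of_cle_pre {e e' : O.Trans} {b : O.Place} (hb : b ∈ O.pre e')
    (h : O.cle (Sum.inr e) (Sum.inl b)) : O.evLE e e' :=
  Relation.ReflTransGen.tail h hb

theorem evLE_of_post_pre {e e' : O.Trans} {b : O.Place} (hb : b ∈ O.post e) (hb' : b ∈ O.pre e') :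
    O.evLE e e' :=
  evLE_of_cle_pre hb' (Relation.ReflTransGen.single hb)

theorem exists_evLE_of_cle {e : O.Trans} {b : O.Place} (h : O.cle (Sum.inr e) (Sum.inl b)) :
    ∃ e', b ∈ O.post e' ∧ O.evLE e e' := by
  rcases Relation.ReflTransGen.cases_tail h with h | ⟨c, hc, hcb⟩
  · cases h
  · rcases c with b' | e'
    · exact hcb.elim
    · exact ⟨e', hcb, hc⟩

theorem eq_or_cle_pre_of_evLE {e e' : O.Trans} (h : O.evLE e e') :
    e = e' ∨ ∃ b ∈ O.pre e', O.cle (Sum.inr e) (Sum.inl b) := by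
  rcases Relation.ReflTransGen.cases_tail h with h | ⟨c, hc, hcb⟩
  · exact Or.inl (Sum.inr.inj h).symm
  · rcases c with b' | e'
    · exact Or.inr ⟨b', hcb, hc⟩
    · exact hcb.elim

theorem condPre_eq_none_iff {b : O.Place} : O.condPre b = none ↔ ∀ e, b ∉ O.post e := by
  unfold condPre
  split
  · rename_i hb
    simp only [reduceCtorEq, false_iff, not_forall, not_not]
    exact ⟨hb.choose.1, hb.choose.2, hb.choose_spec⟩
  · rename_i hb
    simp only [true_iff]
    rintro e ⟨v, hv⟩
    exact hb ⟨(e, v), hv⟩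

theorem mem_B0_iff {b : O.Place} : b ∈ O.B0 ↔ ∀ e, b ∉ O.post e := condPre_eq_none_iff

theorem mem_B0_or_exists_post (b : O.Place) : b ∈ O.B0 ∨ ∃ e, b ∈ O.post e := by
  rw [mem_B0_iff, ← not_exists]
  exact (em _).symm

theorem UniqueInput.condPre_eq (hO : O.UniqueInput) {b : O.Place} {e : O.Trans} {v : Var}
    (hb : (b, v) ∈ O.postFlow e) : O.condPre b = some (e, v) := by
  have hex : ∃ ev : O.Trans × Var, (b, ev.2) ∈ O.postFlow ev.1 := ⟨(e, v), hb⟩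
  unfold condPre
  rw [dif_pos hex]
  obtain ⟨h₁, h₂⟩ := hO _ _ _ _ _ hb hex.choose_spec
  exact congrArg some (Prod.ext h₁ h₂)

theorem UniqueInput.eq_of_mem_post (hO : O.UniqueInput) {b : O.Place} {e e' : O.Trans}
    (hb : b ∈ O.post e) (hb' : b ∈ O.post e') : e = e' := by
  obtain ⟨v, hv⟩ := hb
  obtain ⟨v', hv'⟩ := hb'
  exact (hO _ _ _ _ _ hv' hv).1

theorem UniqueInput.valOf_eq (hO : O.UniqueInput) {b : O.Place} {e : O.Trans} {v : Var}
    (hb : (b, v) ∈ O.postFlow e) (ι : O.Assign) : O.valOf ι b = ι (Sum.inl (e, v)) := by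
  unfold valOf
  rw [hO.condPre_eq hb]

theorem valOf_eq_of_mem_B0 {b : O.Place} (hb : b ∈ O.B0) (ι : O.Assign) :
    O.valOf ι b = ι (Sum.inr b) := by
  unfold valOf
  rw [show O.condPre b = none from hb]

theorem IsOccNet.wellFormed (hO : O.IsOccNet) : O.WellFormed := hO.1

theorem IsOccNet.ordinary (hO : O.IsOccNet) : O.Ordinary := hO.2.1

theorem IsOccNet.not_self_conflict (hO : O.IsOccNet) (e : O.Trans) :
    ¬ O.SConflict (Sum.inr e) (Sum.inr e) := hO.2.2.1 e

theorem IsOccNet.not_clt_self (hO : O.IsOccNet) (x : O.Node) : ¬ O.clt x x := hO.2.2.2.1 x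

theorem IsOccNet.wellFounded (hO : O.IsOccNet) : WellFounded O.clt := hO.2.2.2.2.1

theorem IsOccNet.uniqueInput (hO : O.IsOccNet) : O.UniqueInput := by
  intro e v e' v' b hb hb'
  rcases hO.2.2.2.2.2 b with ⟨h, -⟩ | ⟨⟨e₀, v₀, -, h⟩, -⟩
  · exact (h e v hb).elim
  · obtain ⟨rfl, rfl⟩ := h _ _ hb
    obtain ⟨rfl, rfl⟩ := h _ _ hb'
    exact ⟨rfl, rfl⟩

theorem IsOccNet.card_filter_of_mem_B0 (hO : O.IsOccNet) {b : O.Place} (hb : b ∈ O.B0)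
    {K : O.Marking} (hK : K ∈ O.init) : (K.filter fun bc => bc.1 = b).card = 1 := by
  rcases hO.2.2.2.2.2 b with ⟨-, h⟩ | ⟨⟨e₀, v₀, h, -⟩, -⟩
  · exact h K hK
  · exact (mem_B0_iff.mp hb e₀ ⟨v₀, h⟩).elim

theorem IsOccNet.card_filter_of_notMem_B0 (hO : O.IsOccNet) {b : O.Place} (hb : b ∉ O.B0)
    {K : O.Marking} (hK : K ∈ O.init) : (K.filter fun bc => bc.1 = b).card = 0 := by
  rcases hO.2.2.2.2.2 b with ⟨h, -⟩ | ⟨-, h⟩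
  · exact (hb (mem_B0_iff.mpr fun e ⟨v, hv⟩ => h e v hv)).elim
  · exact h K hK

theorem IsOccNet.count_map_fst (hO : O.IsOccNet) {K : O.Marking} (hK : K ∈ O.init) (b : O.Place) :
    (K.map Prod.fst).count b = if b ∈ O.B0 then 1 else 0 := by
  have : (K.map Prod.fst).count b = (K.filter fun bc => bc.1 = b).card := by
    rw [Multiset.count_map]
    simp [eq_comm]
  rw [this]
  split_ifs with hb
  · exact hO.card_filter_of_mem_B0 hb hK
  · exact hO.card_filter_of_notMem_B0 hb hK

theorem IsOccNet.mem_B0_iff_exists_mem (hO : O.IsOccNet) {K : O.Marking} (hK : K ∈ O.init)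
    (b : O.Place) : b ∈ O.B0 ↔ ∃ c, (b, c) ∈ K := by
  have h := hO.count_map_fst hK b
  rw [show (∃ c, (b, c) ∈ K) ↔ b ∈ K.map Prod.fst by simp, ← Multiset.one_le_count_iff_mem, h]
  split_ifs with hb <;> simp [hb]

theorem IsOccNet.B0_finite (hO : O.IsOccNet) : O.B0.Finite := by
  obtain ⟨K, hK⟩ := hO.wellFormed.1
  refine (K.map Prod.fst).toFinset.finite_toSet.subset fun b hb => ?_
  simpa using (hO.mem_B0_iff_exists_mem hK b).mp hb

theorem IsOccNet.cut_finite (hO : O.IsOccNet) {C : Set O.Trans} (hC : C.Finite) :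
    (O.cut C).Finite :=
  (hO.B0_finite.union (postConds_finite hC)).subset Set.sdiff_subset

theorem IsOccNet.nodup_map_fst_preFlow (hO : O.IsOccNet) (e : O.Trans) :
    ((O.preFlow e).map Prod.fst).Nodup :=
  nodup_map_of_card_filter_le_one _ _ (hO.ordinary.1 e)

theorem IsOccNet.nodup_map_fst_postFlow (hO : O.IsOccNet) (e : O.Trans) :
    ((O.postFlow e).map Prod.fst).Nodup :=
  nodup_map_of_card_filter_le_one _ _ (hO.ordinary.2 e)

theorem IsOccNet.evLE_antisymm (hO : O.IsOccNet) {e e' : O.Trans} (h : O.evLE e e')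
    (h' : O.evLE e' e) : e = e' := by
  rcases Relation.reflTransGen_iff_eq_or_transGen.mp h with h | h
  · exact (Sum.inr.inj h).symm
  · exact (hO.not_clt_self _ (Relation.TransGen.trans_left h h')).elim

theorem IsOccNet.notMem_pre_of_mem_post (hO : O.IsOccNet) {e : O.Trans} {b : O.Place}
    (hb : b ∈ O.post e) : b ∉ O.pre e := fun hb' =>
  hO.not_clt_self (Sum.inr e)
    (Relation.TransGen.trans (b := Sum.inl b) (Relation.TransGen.single hb)
      (Relation.TransGen.single hb'))

theorem closed_cone (e : O.Trans) : O.Closed (O.cone e) := fun _ h _ h' => evLE_trans h' h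

theorem IsOccNet.conflictFree_cone (hO : O.IsOccNet) (e : O.Trans) : O.ConflictFree (O.cone e) := by
  rintro e₁ h₁ e₂ h₂ ⟨b, t₁, t₂, hne, hb₁, hb₂, hc₁, hc₂⟩
  exact hO.not_self_conflict e ⟨b, t₁, t₂, hne, hb₁, hb₂, evLE_trans hc₁ h₁, evLE_trans hc₂ h₂⟩

theorem mem_cone_self (e : O.Trans) : e ∈ O.cone e := evLE_refl e

theorem cone_subset {C : Set O.Trans} (hC : O.Closed C) {e : O.Trans} (he : e ∈ C) :
    O.cone e ⊆ C := fun e' he' => hC e he e' he'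

theorem IsOccNet.closed_cone_diff (hO : O.IsOccNet) (e : O.Trans) :
    O.Closed (O.cone e \ {e}) := by
  rintro e₁ ⟨h₁, hne⟩ e₂ h₂
  refine ⟨evLE_trans h₂ h₁, ?_⟩
  rintro rfl
  exact hne (hO.evLE_antisymm h₁ h₂)

theorem IsOccNet.cone_finite (hO : O.IsOccNet) (e : O.Trans) : (O.cone e).Finite := by
  suffices ∀ x : O.Node, {e' | O.cle (Sum.inr e') x}.Finite from this (Sum.inr e)
  intro x
  induction x using hO.wellFounded.induction with
  | _ x ih =>
    rcases x with b | e
    · rcases mem_B0_or_exists_post b with hb | ⟨e, he⟩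
      · refine Set.finite_empty.subset fun e' he' => ?_
        obtain ⟨e'', h, -⟩ := exists_evLE_of_cle he'
        exact mem_B0_iff.mp hb _ h
      · refine (ih (Sum.inr e) (Relation.TransGen.single he)).subset fun e' he' => ?_
        obtain ⟨e'', h, h'⟩ := exists_evLE_of_cle he'
        rwa [hO.uniqueInput.eq_of_mem_post h he] at h'
    · refine ((Set.finite_singleton e).union ((pre_finite e).biUnion fun b hb =>
        ih (Sum.inl b) (Relation.TransGen.single hb))).subset fun e' he' => ?_
      rcases eq_or_cle_pre_of_evLE he' with rfl | ⟨b, hb, h⟩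
      · exact Or.inl rfl
      · exact Or.inr (Set.mem_biUnion hb h)

/-- Events below a condition available in a causally closed set belong to that set. -/
theorem Closed.mem_of_cle (hO : O.UniqueInput) {C : Set O.Trans} (hC : O.Closed C) {b : O.Place}
    (hb : b ∈ O.B0 ∪ O.postConds C) {e : O.Trans} (h : O.cle (Sum.inr e) (Sum.inl b)) : e ∈ C := by
  obtain ⟨e', he', hle⟩ := exists_evLE_of_cle h
  rcases hb with hb | ⟨e₁, he₁, hb⟩
  · exact (mem_B0_iff.mp hb _ he').elim
  · rw [hO.eq_of_mem_post he' hb] at hle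
    exact hC _ he₁ _ hle

theorem Closed.insert (hO : O.UniqueInput) {C : Set O.Trans} (hC : O.Closed C) {e : O.Trans}
    (hpre : O.pre e ⊆ O.cut C) : O.Closed (insert e C) := by
  rintro e₁ (rfl | he₁) e₂ h
  · rcases eq_or_cle_pre_of_evLE h with rfl | ⟨b, hb, hle⟩
    · exact Or.inl rfl
    · exact Or.inr (hC.mem_of_cle hO (hpre hb).1 hle)
  · exact Or.inr (hC _ he₁ _ h)

theorem ConflictFree.mono {C D : Set O.Trans} (hD : O.ConflictFree D) (h : C ⊆ D) :
    O.ConflictFree C := fun e he e' he' => hD e (h he) e' (h he')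

theorem ConflictFree.eq_of_mem_pre {C : Set O.Trans} (hC : O.ConflictFree C) {e e' : O.Trans}
    (he : e ∈ C) (he' : e' ∈ C) {b : O.Place} (hb : b ∈ O.pre e) (hb' : b ∈ O.pre e') : e = e' := by
  by_contra hne
  exact hC e he e' he' ⟨b, e, e', hne, hb, hb', evLE_refl e, evLE_refl e'⟩

theorem ConflictFree.insert (hO : O.UniqueInput) {C : Set O.Trans} (hC : O.Closed C)
    (hC' : O.ConflictFree C) {e : O.Trans} (hpre : O.pre e ⊆ O.cut C) :
    O.ConflictFree (insert e C) := by
  rintro e₁ h₁ e₂ h₂ ⟨b, t₁, t₂, hne, hb₁, hb₂, hc₁, hc₂⟩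
  have hcl := hC.insert hO hpre
  rcases hcl _ h₁ _ hc₁ with rfl | ht₁
  · rcases hcl _ h₂ _ hc₂ with rfl | ht₂
    · exact hne rfl
    · exact (hpre hb₁).2 ⟨_, ht₂, hb₂⟩
  · rcases hcl _ h₂ _ hc₂ with rfl | ht₂
    · exact (hpre hb₂).2 ⟨_, ht₁, hb₁⟩
    · exact hC' _ ht₁ _ ht₂ ⟨b, t₁, t₂, hne, hb₁, hb₂, evLE_refl _, evLE_refl _⟩

theorem pre_subset_cut {C : Set O.Trans} {e : O.Trans} (he : e ∉ C)
    (hcl : O.Closed (insert e C)) (hcf : O.ConflictFree (insert e C)) (hO : O.IsOccNet) :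
    O.pre e ⊆ O.cut C := by
  intro b hb
  refine ⟨?_, ?_⟩
  · rcases mem_B0_or_exists_post b with h | ⟨e', he'⟩
    · exact Or.inl h
    · refine Or.inr ⟨e', ?_, he'⟩
      rcases hcl e (Or.inl rfl) e' (evLE_of_post_pre he' hb) with rfl | h
      · exact (hO.notMem_pre_of_mem_post he' hb).elim
      · exact h
  · rintro ⟨e', he', hb'⟩
    have := hcf.eq_of_mem_pre (Or.inl rfl) (Or.inr he') hb hb'
    exact he (this ▸ he')

theorem Closed.notMem_preConds {C : Set O.Trans} (hC : O.Closed C) {e : O.Trans} (he : e ∉ C)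
    {b : O.Place} (hb : b ∈ O.post e) : b ∉ O.preConds C := by
  rintro ⟨e', he', hb'⟩
  exact he (hC _ he' _ (evLE_of_post_pre hb hb'))

theorem IsOccNet.notMem_post (hO : O.IsOccNet) {C : Set O.Trans} {e : O.Trans} (he : e ∉ C)
    {b : O.Place} (hb : b ∈ O.B0 ∪ O.postConds C) : b ∉ O.post e := by
  intro hb'
  rcases hb with hb | ⟨e', he', hb⟩
  · exact mem_B0_iff.mp hb _ hb'
  · exact he (hO.uniqueInput.eq_of_mem_post hb' hb ▸ he')

theorem cut_insert (hO : O.IsOccNet) {C : Set O.Trans} (hC : O.Closed C) {e : O.Trans} (he : e ∉ C) :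
    O.cut (insert e C) = (O.cut C \ O.pre e) ∪ O.post e := by
  ext b
  simp only [cut, preConds_insert, postConds_insert, Set.mem_sdiff, Set.mem_union]
  have h₁ := fun hb : b ∈ O.post e => hC.notMem_preConds he hb
  have h₂ := fun hb : b ∈ O.post e => hO.notMem_pre_of_mem_post hb
  tauto

/-- Building a closed finite extension of a closed set one event at a time. -/
theorem closed_induction (hO : O.IsOccNet) {P : Set O.Trans → Prop} {C₀ C : Set O.Trans}
    (hC₀ : O.Closed C₀) (hC : O.Closed C) (hsub : C₀ ⊆ C) (hfin : (C \ C₀).Finite) (h₀ : P C₀)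
    (step : ∀ C' e, O.Closed C' → C₀ ⊆ C' → insert e C' ⊆ C → e ∉ C' → O.Closed (insert e C') →
      P C' → P (insert e C')) : P C := by
  induction hn : (C \ C₀).ncard generalizing C with
  | zero =>
    rw [Set.ncard_eq_zero hfin, Set.sdiff_eq_empty] at hn
    rwa [hn.antisymm hsub]
  | succ n ih =>
    have : Finite ↥(C \ C₀) := hfin
    have : IsTrans ↥(C \ C₀) fun x y => O.evLT y.1 x.1 :=
      ⟨fun _ _ _ h h' => Relation.TransGen.trans h' h⟩
    have : Std.Irrefl fun x y : ↥(C \ C₀) => O.evLT y.1 x.1 := ⟨fun x h => hO.not_clt_self _ h⟩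
    have hwf : WellFounded fun x y : ↥(C \ C₀) => O.evLT y.1 x.1 :=
      Finite.wellFounded_of_trans_of_irrefl _
    have hne : (C \ C₀).Nonempty := by
      rw [← Set.ncard_pos hfin]
      omega
    obtain ⟨⟨e, heC, heC₀⟩, -, hmax⟩ := hwf.has_min Set.univ ⟨⟨_, hne.some_mem⟩, trivial⟩
    have hins : insert e (C \ {e}) = C := by simp [heC]
    have hcl : O.Closed (C \ {e}) := by
      rintro e₁ ⟨h₁, hne₁⟩ e₂ hle
      refine ⟨hC _ h₁ _ hle, ?_⟩
      rintro rfl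
      rcases Relation.reflTransGen_iff_eq_or_transGen.mp hle with h | h
      · exact hne₁ (Sum.inr.inj h)
      · exact hmax ⟨e₁, h₁, fun h' => heC₀ (hC₀ _ h' _ hle)⟩ trivial h
    have hdiff : (C \ {e}) \ C₀ = (C \ C₀) \ {e} := by
      ext x
      simp only [Set.mem_sdiff, Set.mem_singleton_iff]
      tauto
    have hsub' : C₀ ⊆ C \ {e} := fun x hx => ⟨hsub hx, fun h => heC₀ (by rwa [← show x = e from h])⟩
    have hP : ∀ C', C' = C → P C' → P C := fun _ h hP => h ▸ hP
    refine hP _ hins (step _ e hcl hsub' hins.subset (by simp) (by rwa [hins]) ?_)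
    refine ih hcl hsub' (by rw [hdiff]; exact hfin.subset Set.sdiff_subset) (fun C' e' h₁ h₂ h₃ =>
      step C' e' h₁ h₂ (Set.Subset.trans h₃ Set.sdiff_subset)) ?_
    rw [hdiff, Set.ncard_sdiff_singleton_of_mem (show e ∈ C \ C₀ from ⟨heC, heC₀⟩)]
    omega

end Basic

section Firing

variable {O N : HLNet Color Var}

theorem isInst_iff {C : Set O.Trans} (hC : O.Closed C) {ι : O.Assign} :
    O.IsInst C ι ↔ O.predBot ι ∧ ∀ e ∈ C, O.locPred e ι :=
  and_congr_right fun hbot =>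
    ⟨fun h e he => (h e he).2 e (evLE_refl e),
      fun h e he => ⟨hbot, fun e' he' => h e' (hC e he e' he')⟩⟩

theorem IsInst.mono {C D : Set O.Trans} {ι : O.Assign} (h : O.IsInst D ι) (hCD : C ⊆ D) :
    O.IsInst C ι := ⟨h.1, fun e he => h.2 e (hCD he)⟩

theorem isInst_cone {e : O.Trans} {ι : O.Assign} (h : O.pred e ι) : O.IsInst (O.cone e) ι :=
  (isInst_iff (closed_cone e)).mpr h

theorem IsConfig.closed {C : Set O.Trans} (hC : O.IsConfig C) : O.Closed C := hC.1

theorem IsConfig.conflictFree {C : Set O.Trans} (hC : O.IsConfig C) : O.ConflictFree C := hC.2.1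

theorem finCfg_of_subset {C D : Set O.Trans} (hD : O.FinCfg D) (hCD : C ⊆ D) (hC : O.Closed C) :
    O.FinCfg C := by
  obtain ⟨ι, hι⟩ := hD.1.2.2
  exact ⟨⟨hC, hD.1.conflictFree.mono hCD, ι, hι.mono hCD⟩, hD.2.subset hCD⟩

theorem IsSBP.isOccNet {h : Hom O N} (hS : IsSBP h) : O.IsOccNet := hS.1

theorem IsSBP.finCfg_cone {h : Hom O N} (hS : IsSBP h) (e : O.Trans) : O.FinCfg (O.cone e) := by
  obtain ⟨ι, hι⟩ := hS.2.2.1 e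
  exact ⟨⟨closed_cone e, hS.isOccNet.conflictFree_cone e, ι, isInst_cone hι⟩,
    hS.isOccNet.cone_finite e⟩

/-- The assignment `ι` with the variables of the event `e` set according to the mode `σ`. -/
def Assign.setMode (ι : O.Assign) (e : O.Trans) (σ : Var → Color) : O.Assign
  | Sum.inl (e', v) => if e' = e then σ v else ι (Sum.inl (e', v))
  | Sum.inr b => ι (Sum.inr b)

theorem valOf_setMode_of_notMem (hO : O.UniqueInput) (ι : O.Assign) {e : O.Trans}
    (σ : Var → Color) {b : O.Place} (hb : b ∉ O.post e) :
    O.valOf (ι.setMode e σ) b = O.valOf ι b := by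
  rcases mem_B0_or_exists_post b with h | ⟨e', v, hv⟩
  · rw [valOf_eq_of_mem_B0 h, valOf_eq_of_mem_B0 h]
    rfl
  · rw [hO.valOf_eq hv, hO.valOf_eq hv]
    refine if_neg ?_
    rintro rfl
    exact hb ⟨v, hv⟩

theorem valOf_setMode_of_mem (hO : O.UniqueInput) (ι : O.Assign) {e : O.Trans}
    (σ : Var → Color) {b : O.Place} {v : Var} (hb : (b, v) ∈ O.postFlow e) :
    O.valOf (ι.setMode e σ) b = σ v := by
  rw [hO.valOf_eq hb]
  exact if_pos rfl

theorem IsInst.setMode (hO : O.IsOccNet) {C : Set O.Trans} (hC : O.Closed C) {ι : O.Assign}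
    (hι : O.IsInst C ι) {e : O.Trans} (he : e ∉ C) (hpre : O.pre e ⊆ O.cut C) {σ : Var → Color}
    (hg : O.guard e σ) (hval : ∀ bv ∈ O.preFlow e, σ bv.2 = O.valOf ι bv.1) :
    O.IsInst (insert e C) (ι.setMode e σ) := by
  rw [isInst_iff hC] at hι
  rw [isInst_iff (hC.insert hO.uniqueInput hpre)]
  refine ⟨hι.1, ?_⟩
  rintro e' (rfl | he')
  · refine ⟨?_, fun bv hbv => ?_⟩
    · simpa only [Assign.setMode, if_true] using hg
    · rw [valOf_setMode_of_notMem hO.uniqueInput _ _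
        (hO.notMem_post he (hpre ⟨bv.2, hbv⟩).1), ← hval bv hbv]
      exact if_pos rfl
  · have hne : e' ≠ e := fun h => he (h ▸ he')
    obtain ⟨h₁, h₂⟩ := hι.2 e' he'
    refine ⟨?_, fun bv hbv => ?_⟩
    · simpa only [Assign.setMode, if_neg hne] using h₁
    · rw [valOf_setMode_of_notMem hO.uniqueInput, ← h₂ bv hbv]
      · exact if_neg hne
      · intro hb
        exact he (hC _ he' _ (evLE_of_post_pre hb ⟨bv.2, hbv⟩))

theorem FinCfg.insert (hO : O.IsOccNet) {C : Set O.Trans} (hC : O.FinCfg C) {ι : O.Assign}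
    (hι : O.IsInst C ι) {e : O.Trans} (he : e ∉ C) (hpre : O.pre e ⊆ O.cut C) {σ : Var → Color}
    (hg : O.guard e σ) (hval : ∀ bv ∈ O.preFlow e, σ bv.2 = O.valOf ι bv.1) :
    O.FinCfg (insert e C) :=
  ⟨⟨hC.1.closed.insert hO.uniqueInput hpre,
    hC.1.conflictFree.insert hO.uniqueInput hC.1.closed hpre,
    _, hι.setMode hO hC.1.closed he hpre hg hval⟩, hC.2.insert e⟩

theorem mark_congr (h : Hom O N) {C C' : Set O.Trans} (hC : O.cut C = O.cut C')
    (hfin : (O.cut C).Finite) (hfin' : (O.cut C').Finite) {ι ι' : O.Assign}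
    (hι : ∀ b ∈ O.cut C, O.valOf ι b = O.valOf ι' b) : mark h hfin ι = mark h hfin' ι' := by
  have : hfin.toFinset = hfin'.toFinset := by
    ext b
    simp [hC]
  unfold mark
  rw [← this]
  exact Multiset.map_congr rfl fun b hb => by rw [hι b (by simpa using hb)]

theorem map_preFlow_eq_preMark (h : Hom O N) (e : O.Trans) (σ : Var → Color) (c : O.Place → Color)
    (hc : ∀ bv ∈ O.preFlow e, σ bv.2 = c bv.1) :
    ((O.preFlow e).map Prod.fst).map (fun b => (h.mapP b, c b)) = N.preMark (h.mapT e) σ := by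
  unfold preMark
  rw [h.pre_eq, Multiset.map_map, Multiset.map_map]
  exact Multiset.map_congr rfl fun bv hbv => by simp [hc bv hbv]

theorem map_postFlow_eq_postMark (h : Hom O N) (e : O.Trans) (σ : Var → Color)
    (c : O.Place → Color) (hc : ∀ bv ∈ O.postFlow e, σ bv.2 = c bv.1) :
    ((O.postFlow e).map Prod.fst).map (fun b => (h.mapP b, c b)) = N.postMark (h.mapT e) σ := by
  unfold postMark
  rw [h.post_eq, Multiset.map_map, Multiset.map_map]
  exact Multiset.map_congr rfl fun bv hbv => by simp [hc bv hbv]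

theorem mem_map_fst_preFlow {e : O.Trans} {b : O.Place} :
    b ∈ (O.preFlow e).map Prod.fst ↔ b ∈ O.pre e := by simp [pre]

theorem mem_map_fst_postFlow {e : O.Trans} {b : O.Place} :
    b ∈ (O.postFlow e).map Prod.fst ↔ b ∈ O.post e := by simp [post]

theorem map_fst_preFlow_le_cut (hO : O.IsOccNet) {C : Set O.Trans} {e : O.Trans}
    (hpre : O.pre e ⊆ O.cut C) (hfin : (O.cut C).Finite) :
    (O.preFlow e).map Prod.fst ≤ hfin.toFinset.val := by
  rw [Multiset.le_iff_subset (hO.nodup_map_fst_preFlow e)]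
  intro b hb
  simpa using hpre (mem_map_fst_preFlow.mp hb)

/-- Adding an event enabled at the cut of a closed set corresponds to firing its label. -/
theorem mark_firesTo (hO : O.IsOccNet) (h : Hom O N) {C : Set O.Trans} (hC : O.Closed C)
    {e : O.Trans} (he : e ∉ C) (hpre : O.pre e ⊆ O.cut C) {ι : O.Assign} (hloc : O.locPred e ι)
    (hfin : (O.cut C).Finite) (hfin' : (O.cut (insert e C)).Finite) :
    N.firesTo (mark h hfin ι) (h.mapT e) (fun v => ι (Sum.inl (e, v))) (mark h hfin' ι) := by
  have hcut : hfin'.toFinset.val + (O.preFlow e).map Prod.fst =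
      hfin.toFinset.val + (O.postFlow e).map Prod.fst := by
    ext b
    have h₁ : b ∈ O.post e → b ∉ O.cut C := fun hb hb' => hO.notMem_post he hb'.1 hb
    have h₂ : b ∈ O.post e → b ∉ O.pre e := fun hb => hO.notMem_pre_of_mem_post hb
    have h₃ : b ∈ O.pre e → b ∈ O.cut C := fun hb => hpre hb
    rw [Multiset.count_add, Multiset.count_add,
      Multiset.count_eq_of_nodup (Finset.nodup _), Multiset.count_eq_of_nodup (Finset.nodup _),
      Multiset.count_eq_of_nodup (hO.nodup_map_fst_preFlow e),
      Multiset.count_eq_of_nodup (hO.nodup_map_fst_postFlow e)]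
    simp only [mem_map_fst_preFlow, mem_map_fst_postFlow, Finset.mem_val,
      Set.Finite.mem_toFinset, cut_insert hO hC he, Set.mem_union, Set.mem_sdiff]
    by_cases hb₁ : b ∈ O.post e <;> by_cases hb₂ : b ∈ O.pre e <;>
      by_cases hb₃ : b ∈ O.cut C <;> simp_all
  have hpreM := map_preFlow_eq_preMark h e (fun v => ι (Sum.inl (e, v))) (O.valOf ι) hloc.2
  have hpostM := map_postFlow_eq_postMark h e (fun v => ι (Sum.inl (e, v))) (O.valOf ι)
    fun bv hbv => (hO.uniqueInput.valOf_eq hbv ι).symm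
  have hle : N.preMark (h.mapT e) (fun v => ι (Sum.inl (e, v))) ≤ mark h hfin ι := by
    rw [← hpreM]
    exact Multiset.map_le_map (map_fst_preFlow_le_cut hO hpre hfin)
  have hsum := congrArg (Multiset.map fun b => (h.mapP b, O.valOf ι b)) hcut
  rw [Multiset.map_add, Multiset.map_add, hpreM, hpostM] at hsum
  refine ⟨⟨(h.guard_iff _ _).mp hloc.1, hle⟩, ?_⟩
  rw [tsub_add_eq_add_tsub hle]
  exact eq_tsub_of_add_eq hsum

theorem IsOccNet.init_eq (hO : O.IsOccNet) {K : O.Marking} (hK : K ∈ O.init)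
    (hfin : (O.cut ∅).Finite) {ι : O.Assign} (hι : ∀ b c, (b, c) ∈ K → ι (Sum.inr b) = c) :
    hfin.toFinset.val.map (fun b => (b, O.valOf ι b)) = K := by
  have hval : hfin.toFinset.val = K.map Prod.fst := by
    ext b
    rw [hO.count_map_fst hK, Multiset.count_eq_of_nodup (Finset.nodup _)]
    simp [cut, mem_preConds, mem_postConds]
  rw [hval, Multiset.map_map]
  conv_rhs => rw [← Multiset.map_id K]
  refine Multiset.map_congr rfl fun bc hbc => ?_
  have hb : bc.1 ∈ O.B0 := (hO.mem_B0_iff_exists_mem hK _).mpr ⟨bc.2, hbc⟩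
  simp [valOf_eq_of_mem_B0 hb, hι bc.1 bc.2 hbc]

theorem mark_empty_mem_init (hO : O.IsOccNet) {h : Hom O N} (hi : h.Initial)
    (hfin : (O.cut ∅).Finite) {ι : O.Assign} (hι : O.predBot ι) : mark h hfin ι ∈ N.init := by
  obtain ⟨K, hK, hKι⟩ := hι
  rw [← hi]
  refine ⟨K, hK, ?_⟩
  conv_lhs => rw [← hO.init_eq hK hfin hKι]
  rw [Hom.mapMarking, Multiset.map_map]
  rfl

/-- The marking of a finite instantiated configuration is reachable. -/
theorem reach_mark {h : Hom O N} (hS : IsSBP h) {C : Set O.Trans} (hC : O.FinCfg C)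
    {ι : O.Assign} (hι : O.IsInst C ι) (hfin : (O.cut C).Finite) : N.Reach (mark h hfin ι) := by
  have hO := hS.isOccNet
  revert hfin
  refine closed_induction (P := fun C' => ∀ hfin : (O.cut C').Finite, N.Reach (mark h hfin ι))
    hO (C₀ := ∅) (C := C) (fun _ h => h.elim) hC.1.closed (Set.empty_subset _)
    (hC.2.subset Set.sdiff_subset) ?_ ?_
  · exact fun hfin => Reach.init (mark_empty_mem_init hO hS.2.1 hfin hι.1)
  · intro C' e hcl _ hsub he hcl' ih hfin
    have hfin' : (O.cut C').Finite :=
      hO.cut_finite (hC.2.subset ((Set.subset_insert _ _).trans hsub))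
    have hpre := pre_subset_cut he hcl' (hC.1.conflictFree.mono hsub) hO
    have hloc := ((isInst_iff hC.1.closed).mp hι).2 e (hsub (Or.inl rfl))
    exact Reach.step (ih hfin') (mark_firesTo hO h hcl he hpre hloc hfin' hfin)

theorem Safe.nodup_map_fst (hN : N.Safe) {M : N.Marking} (hM : N.Reach M) :
    (M.map Prod.fst).Nodup :=
  nodup_map_of_card_filter_le_one _ _ (hN M hM)

theorem map_fst_preMark (t : N.Trans) (σ : Var → Color) :
    (N.preMark t σ).map Prod.fst = (N.preFlow t).map Prod.fst := by
  simp [preMark, Multiset.map_map]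

theorem map_fst_postMark (t : N.Trans) (σ : Var → Color) :
    (N.postMark t σ).map Prod.fst = (N.postFlow t).map Prod.fst := by
  simp [postMark, Multiset.map_map]

theorem Safe.nodup_preFlow (hN : N.Safe) {M : N.Marking} (hM : N.Reach M) {t : N.Trans}
    {σ : Var → Color} (ht : N.fires M t σ) : ((N.preFlow t).map Prod.fst).Nodup := by
  rw [← map_fst_preMark t σ]
  exact Multiset.nodup_of_le (Multiset.map_le_map ht.2) (hN.nodup_map_fst hM)

theorem Safe.nodup_postFlow (hN : N.Safe) {M : N.Marking} (hM : N.Reach M) {t : N.Trans}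
    {σ : Var → Color} (ht : N.fires M t σ) : ((N.postFlow t).map Prod.fst).Nodup := by
  rw [← map_fst_postMark t σ]
  exact Multiset.nodup_of_le (Multiset.map_le_map (Multiset.le_add_left _ _))
    (hN.nodup_map_fst (Reach.step hM ⟨ht, rfl⟩))

/-- In a safe net, a fireable transition without input places has no output places. -/
theorem Safe.postFlow_eq_zero (hN : N.Safe) {M : N.Marking} (hM : N.Reach M) {t : N.Trans}
    {σ : Var → Color} (ht : N.fires M t σ) (hpre : N.preFlow t = 0) : N.postFlow t = 0 := by
  have hp : N.preMark t σ = 0 := by simp [preMark, hpre]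
  have h₁ : N.Reach (M + N.postMark t σ) := Reach.step hM ⟨ht, by rw [hp]; simp⟩
  have h₂ : N.Reach (M + N.postMark t σ + N.postMark t σ) :=
    Reach.step h₁ ⟨⟨ht.1, by rw [hp]; exact Multiset.zero_le _⟩, by rw [hp]; simp⟩
  have hnd := hN.nodup_map_fst h₂
  rw [Multiset.map_add, Multiset.map_add, map_fst_postMark] at hnd
  refine Multiset.eq_zero_of_forall_notMem fun pv hpv => ?_
  have hmem := Multiset.mem_map_of_mem Prod.fst hpv
  exact Multiset.disjoint_left.mp (Multiset.nodup_add.mp hnd).2.2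
    (Multiset.mem_add.mpr (Or.inr hmem)) hmem

/-- Every event of a symbolic branching process fires from some reachable marking. -/
theorem IsSBP.exists_reach_fires {h : Hom O N} (hS : IsSBP h) (e : O.Trans) :
    ∃ M σ, N.Reach M ∧ N.fires M (h.mapT e) σ := by
  have hO := hS.isOccNet
  obtain ⟨ι, hι⟩ := hS.2.2.1 e
  have hcl := hO.closed_cone_diff e
  have hins : insert e (O.cone e \ {e}) = O.cone e := by simp [mem_cone_self]
  have hcfg : O.FinCfg (O.cone e \ {e}) := finCfg_of_subset (hS.finCfg_cone e) Set.sdiff_subset hcl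
  have hpre : O.pre e ⊆ O.cut (O.cone e \ {e}) :=
    pre_subset_cut (by simp) (by rw [hins]; exact closed_cone e)
      (by rw [hins]; exact hO.conflictFree_cone e) hO
  have hfin := hO.cut_finite hcfg.2
  have hfin' : (O.cut (insert e (O.cone e \ {e}))).Finite := hO.cut_finite (hcfg.2.insert e)
  refine ⟨mark h hfin ι, _, reach_mark hS hcfg ((isInst_cone hι).mono Set.sdiff_subset) hfin,
    (mark_firesTo hO h hcl (by simp) hpre (hι.2 e (evLE_refl e)) hfin hfin').1⟩

theorem IsSBP.nodup_postFlow {h : Hom O N} (hS : IsSBP h) (hN : N.Safe) (e : O.Trans) :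
    ((N.postFlow (h.mapT e)).map Prod.fst).Nodup := by
  obtain ⟨M, σ, hM, hf⟩ := hS.exists_reach_fires e
  exact hN.nodup_postFlow hM hf

theorem IsSBP.injOn_post {h : Hom O N} (hS : IsSBP h) (hN : N.Safe) (e : O.Trans) :
    Set.InjOn h.mapP (O.post e) := by
  have hnd := hS.nodup_postFlow hN e
  rw [h.post_eq, Multiset.map_map] at hnd
  rintro b ⟨v, hv⟩ b' ⟨v', hv'⟩ hbb
  exact congrArg Prod.fst (map_injOn_of_nodup_map _ _ hnd hv hv' hbb)

theorem IsSBP.post_eq_empty {h : Hom O N} (hS : IsSBP h) (hN : N.Safe) {e : O.Trans}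
    (he : O.preFlow e = 0) : O.post e = ∅ := by
  obtain ⟨M, σ, hM, hf⟩ := hS.exists_reach_fires e
  have h₀ := hN.postFlow_eq_zero hM hf (by rw [h.pre_eq, he]; rfl)
  rw [h.post_eq, Multiset.map_eq_zero] at h₀
  ext b
  simp [post, h₀]

theorem IsSBP.injOn_B0 {h : Hom O N} (hS : IsSBP h) (hN : N.Safe) : Set.InjOn h.mapP O.B0 := by
  have hO := hS.isOccNet
  obtain ⟨K, hK⟩ := hO.wellFormed.1
  have hM : N.Reach (h.mapMarking K) := Reach.init (hS.2.1 ▸ ⟨K, hK, rfl⟩)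
  have hnd := hN.nodup_map_fst hM
  rw [Hom.mapMarking, Multiset.map_map] at hnd
  intro b hb b' hb' hbb
  obtain ⟨c, hc⟩ := (hO.mem_B0_iff_exists_mem hK b).mp hb
  obtain ⟨c', hc'⟩ := (hO.mem_B0_iff_exists_mem hK b').mp hb'
  exact congrArg Prod.fst (map_injOn_of_nodup_map _ _ hnd hc hc' hbb)

end Firing

section Extension

variable {O N : HLNet Color Var}

/-- The net `O` extended by one event with label `t` and preset `w`, together with a fresh
postset. -/
def extend (O N : HLNet Color Var) (t : N.Trans) (w : Multiset (O.Place × Var)) :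
    HLNet Color Var where
  Place := O.Place ⊕ {pv : N.Place × Var // pv ∈ N.postFlow t}
  Trans := Option O.Trans
  preFlow
    | none => w.map fun bv => (Sum.inl bv.1, bv.2)
    | some e => (O.preFlow e).map fun bv => (Sum.inl bv.1, bv.2)
  postFlow
    | none => (N.postFlow t).attach.map fun x => (Sum.inr x, x.1.2)
    | some e => (O.postFlow e).map fun bv => (Sum.inl bv.1, bv.2)
  guard
    | none => N.guard t
    | some e => O.guard e
  init := (fun K : O.Marking => K.map fun bc => (Sum.inl bc.1, bc.2)) '' O.init

/-- The labeling of the extended net. -/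
def extendHom (h : Hom O N) (t : N.Trans) (w : Multiset (O.Place × Var))
    (hw : N.preFlow t = w.map fun bv => (h.mapP bv.1, bv.2)) : Hom (extend O N t w) N where
  mapP := Sum.elim h.mapP fun x => x.1.1
  mapT
    | none => t
    | some e => h.mapT e
  guard_iff
    | none, _ => Iff.rfl
    | some e, σ => h.guard_iff e σ
  pre_eq
    | none => by
      simp only [extend, Multiset.map_map]
      exact hw
    | some e => by
      simp only [extend, Multiset.map_map]
      exact h.pre_eq e
  post_eq
    | none => by
      simp only [extend, Multiset.map_map]
      conv_lhs => rw [← Multiset.attach_map_val (N.postFlow t)]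
      rfl
    | some e => by
      simp only [extend, Multiset.map_map]
      exact h.post_eq e

variable {t : N.Trans} {w : Multiset (O.Place × Var)}

theorem inl_mem_map_inl {α β γ : Type} {s : Multiset (α × γ)} {b : α} {v : γ} :
    ((Sum.inl b : α ⊕ β), v) ∈ (s.map fun bv => ((Sum.inl bv.1 : α ⊕ β), bv.2)) ↔ (b, v) ∈ s := by
  simp

theorem inr_notMem_map_inl {α β γ : Type} {s : Multiset (α × γ)} {b : β} {v : γ} :
    ((Sum.inr b : α ⊕ β), v) ∉ (s.map fun bv => ((Sum.inl bv.1 : α ⊕ β), bv.2)) := by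
  simp

theorem extend_mem_preFlow_some {e : O.Trans} {b : O.Place} {v : Var} :
    (Sum.inl b, v) ∈ (extend O N t w).preFlow (some e) ↔ (b, v) ∈ O.preFlow e :=
  inl_mem_map_inl

theorem extend_mem_preFlow_none {b : O.Place} {v : Var} :
    (Sum.inl b, v) ∈ (extend O N t w).preFlow none ↔ (b, v) ∈ w :=
  inl_mem_map_inl

theorem extend_inr_notMem_preFlow {e : (extend O N t w).Trans} {x : {pv // pv ∈ N.postFlow t}}
    {v : Var} : (Sum.inr x, v) ∉ (extend O N t w).preFlow e := by
  cases e <;> exact inr_notMem_map_inl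

theorem extend_mem_postFlow_some {e : O.Trans} {b : O.Place} {v : Var} :
    (Sum.inl b, v) ∈ (extend O N t w).postFlow (some e) ↔ (b, v) ∈ O.postFlow e :=
  inl_mem_map_inl

theorem extend_inl_notMem_postFlow_none {b : O.Place} {v : Var} :
    (Sum.inl b, v) ∉ (extend O N t w).postFlow none := by
  intro h
  obtain ⟨y, -, hy⟩ := Multiset.mem_map.mp h
  exact Sum.inr_ne_inl (Prod.mk.inj hy).1

theorem extend_mem_postFlow_none {x : {pv // pv ∈ N.postFlow t}} {v : Var} :
    (Sum.inr x, v) ∈ (extend O N t w).postFlow none ↔ v = x.1.2 := by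
  constructor
  · intro h
    obtain ⟨y, -, hy⟩ := Multiset.mem_map.mp h
    obtain ⟨h₁, h₂⟩ := Prod.mk.inj hy
    rw [← h₂, Sum.inr.inj h₁]
  · rintro rfl
    exact Multiset.mem_map.mpr ⟨x, Multiset.mem_attach _ _, rfl⟩

theorem extend_inr_notMem_postFlow_some {e : O.Trans} {x : {pv // pv ∈ N.postFlow t}}
    {v : Var} : (Sum.inr x, v) ∉ (extend O N t w).postFlow (some e) :=
  inr_notMem_map_inl

/-- The inclusion of the nodes of a net into those of its extension. -/
def extendNode (O N : HLNet Color Var) (t : N.Trans) (w : Multiset (O.Place × Var)) :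
    O.Node → (extend O N t w).Node :=
  Sum.map Sum.inl some

theorem extend_arc_old {x : (extend O N t w).Node} {y : O.Node}
    (hxy : (extend O N t w).arc x (extendNode O N t w y)) :
    ∃ x', x = extendNode O N t w x' ∧ O.arc x' y := by
  rcases y with b | e <;> rcases x with (b' | x') | (_ | e')
  · exact hxy.elim
  · exact hxy.elim
  · obtain ⟨v, hv⟩ := hxy
    exact (extend_inl_notMem_postFlow_none hv).elim
  · obtain ⟨v, hv⟩ := hxy
    exact ⟨Sum.inr e', rfl, v, extend_mem_postFlow_some.mp hv⟩
  · obtain ⟨v, hv⟩ := hxy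
    exact ⟨Sum.inl b', rfl, v, extend_mem_preFlow_some.mp hv⟩
  · obtain ⟨v, hv⟩ := hxy
    exact (extend_inr_notMem_preFlow hv).elim
  · exact hxy.elim
  · exact hxy.elim

theorem extend_cle_old {x : (extend O N t w).Node} {y : O.Node}
    (hxy : (extend O N t w).cle x (extendNode O N t w y)) :
    ∃ x', x = extendNode O N t w x' ∧ O.cle x' y := by
  induction hxy using Relation.ReflTransGen.head_induction_on with
  | refl => exact ⟨y, rfl, Relation.ReflTransGen.refl⟩
  | head hab _ ih =>
    obtain ⟨z, rfl, hz⟩ := ih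
    obtain ⟨x', rfl, hx'⟩ := extend_arc_old hab
    exact ⟨x', rfl, Relation.ReflTransGen.head hx' hz⟩

theorem extend_evLE_some {e' : (extend O N t w).Trans} {e : O.Trans}
    (h : (extend O N t w).evLE e' (some e)) : ∃ e₀, e' = some e₀ ∧ O.evLE e₀ e := by
  obtain ⟨x, hx, hle⟩ := extend_cle_old (y := Sum.inr e) h
  rcases x with b | e₀
  · cases hx
  · exact ⟨e₀, Sum.inr.inj hx, hle⟩

theorem extend_evLE_none {e : (extend O N t w).Trans}
    (h : (extend O N t w).evLE e none) :
    e = none ∨ ∃ e₀, e = some e₀ ∧ ∃ bv ∈ w, O.cle (Sum.inr e₀) (Sum.inl bv.1) := by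
  rcases eq_or_cle_pre_of_evLE h with rfl | ⟨b | x, ⟨v, hb⟩, hle⟩
  · exact Or.inl rfl
  · right
    obtain ⟨x, hx, hle'⟩ := extend_cle_old (y := Sum.inl b) hle
    rcases x with b' | e₀
    · cases hx
    · exact ⟨e₀, Sum.inr.inj hx, (b, v), extend_mem_preFlow_none.mp hb, hle'⟩
  · exact (extend_inr_notMem_preFlow hb).elim

theorem extend_wellFounded (hO : O.IsOccNet) : WellFounded (extend O N t w).clt := by
  have hwf : WellFounded O.arc :=
    Subrelation.wf (fun h => Relation.TransGen.single h) hO.wellFounded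
  let ν : (extend O N t w).Node → O.Node ⊕ ℕ
    | Sum.inl (Sum.inl b) => Sum.inl (Sum.inl b)
    | Sum.inl (Sum.inr _) => Sum.inr 1
    | Sum.inr none => Sum.inr 0
    | Sum.inr (some e) => Sum.inl (Sum.inr e)
  have hlex : WellFounded (Sum.Lex O.arc ((· < ·) : ℕ → ℕ → Prop)) :=
    Sum.lex_wf hwf Nat.lt_wfRel.wf
  refine WellFounded.transGen (Subrelation.wf (r := InvImage _ ν) ?_ (InvImage.wf ν hlex))
  intro x y hxy
  show Sum.Lex _ _ (ν x) (ν y)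
  rcases y with (b | y) | (_ | e)
  · obtain ⟨x', rfl, hx'⟩ := extend_arc_old (y := Sum.inl b) hxy
    rcases x' with b' | e' <;> exact Sum.Lex.inl hx'
  · rcases x with b | (_ | e)
    · exact hxy.elim
    · exact Sum.Lex.inr Nat.zero_lt_one
    · exact Sum.Lex.sep _ _
  · rcases x with (b | x) | e
    · exact Sum.Lex.sep _ _
    · obtain ⟨v, hv⟩ := hxy
      exact (extend_inr_notMem_preFlow hv).elim
    · exact hxy.elim
  · obtain ⟨x', rfl, hx'⟩ := extend_arc_old (y := Sum.inr e) hxy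
    rcases x' with b' | e' <;> exact Sum.Lex.inl hx'

theorem extend_uniqueInput (hO : O.UniqueInput) : (extend O N t w).UniqueInput := by
  rintro (_ | e) v (_ | e') v' (b | x) h₁ h₂
  · exact (extend_inl_notMem_postFlow_none h₁).elim
  · exact ⟨rfl, (extend_mem_postFlow_none.mp h₂).trans (extend_mem_postFlow_none.mp h₁).symm⟩
  · exact (extend_inl_notMem_postFlow_none h₁).elim
  · exact (extend_inr_notMem_postFlow_some h₂).elim
  · exact (extend_inl_notMem_postFlow_none h₂).elim
  · exact (extend_inr_notMem_postFlow_some h₁).elim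
  · obtain ⟨rfl, rfl⟩ := hO _ _ _ _ _ (extend_mem_postFlow_some.mp h₁)
      (extend_mem_postFlow_some.mp h₂)
    exact ⟨rfl, rfl⟩
  · exact (extend_inr_notMem_postFlow_some h₁).elim

/-- The assignment for the extended net given by an assignment for the original net and a mode
of the additional event. -/
def extendAssign (t : N.Trans) (w : Multiset (O.Place × Var)) (ι : O.Assign) (σ : Var → Color) :
    (extend O N t w).Assign
  | Sum.inl (none, v) => σ v
  | Sum.inl (some e, v) => ι (Sum.inl (e, v))
  | Sum.inr (Sum.inl b) => ι (Sum.inr b)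
  | Sum.inr (Sum.inr x) => σ x.1.2

theorem extend_valOf (hO : O.UniqueInput) (ι : O.Assign) (σ : Var → Color) (b : O.Place) :
    (extend O N t w).valOf (extendAssign t w ι σ) (Sum.inl b) = O.valOf ι b := by
  rcases mem_B0_or_exists_post b with hb | ⟨e, v, hv⟩
  · refine (valOf_eq_of_mem_B0 (mem_B0_iff.mpr ?_) _).trans (valOf_eq_of_mem_B0 hb ι).symm
    rintro (_ | e) ⟨v, hv⟩
    · exact extend_inl_notMem_postFlow_none hv
    · exact mem_B0_iff.mp hb e ⟨v, extend_mem_postFlow_some.mp hv⟩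
  · rw [hO.valOf_eq hv, (extend_uniqueInput hO).valOf_eq (extend_mem_postFlow_some.mpr hv)]
    rfl

theorem extend_predBot {ι : O.Assign} (hι : O.predBot ι) (σ : Var → Color) :
    (extend O N t w).predBot (extendAssign t w ι σ) := by
  obtain ⟨K, hK, h⟩ := hι
  refine ⟨_, ⟨K, hK, rfl⟩, fun b c hbc => ?_⟩
  obtain ⟨⟨b', c'⟩, hbc', heq⟩ := Multiset.mem_map.mp hbc
  cases heq
  exact h _ _ hbc'

theorem extend_locPred_some (hO : O.UniqueInput) {ι : O.Assign} {e : O.Trans}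
    (hι : O.locPred e ι) (σ : Var → Color) :
    (extend O N t w).locPred (some e) (extendAssign t w ι σ) := by
  refine ⟨hι.1, fun bv hbv => ?_⟩
  obtain ⟨bv', hbv', rfl⟩ := Multiset.mem_map.mp hbv
  rw [extend_valOf hO]
  exact hι.2 bv' hbv'

theorem extend_locPred_none (hO : O.UniqueInput) {ι : O.Assign} {σ : Var → Color}
    (hg : N.guard t σ) (hval : ∀ bv ∈ w, σ bv.2 = O.valOf ι bv.1) :
    (extend O N t w).locPred none (extendAssign t w ι σ) := by
  refine ⟨hg, fun bv hbv => ?_⟩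
  obtain ⟨bv', hbv', rfl⟩ := Multiset.mem_map.mp hbv
  rw [extend_valOf hO]
  exact hval bv' hbv'

theorem extend_exists_pred (hO : O.UniqueInput) (hpred : ∀ e : O.Trans, ∃ ι, O.pred e ι)
    {C : Set O.Trans} (hC : O.Closed C) (hw : ∀ bv ∈ w, bv.1 ∈ O.cut C) {ι : O.Assign}
    (hι : O.IsInst C ι) {σ : Var → Color} (hg : N.guard t σ)
    (hval : ∀ bv ∈ w, σ bv.2 = O.valOf ι bv.1) :
    ∀ e : (extend O N t w).Trans, ∃ ι', (extend O N t w).pred e ι' := by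
  rintro (_ | e)
  · refine ⟨extendAssign t w ι σ, extend_predBot hι.1 σ, fun e' he' => ?_⟩
    rcases extend_evLE_none he' with rfl | ⟨e₀, rfl, bv, hbv, hle⟩
    · exact extend_locPred_none hO hg hval
    · exact extend_locPred_some hO (((isInst_iff hC).mp hι).2 e₀
        (hC.mem_of_cle hO (hw bv hbv).1 hle)) σ
  · obtain ⟨ι', hι'⟩ := hpred e
    refine ⟨extendAssign t w ι' σ, extend_predBot hι'.1 σ, fun e' he' => ?_⟩
    obtain ⟨e₀, rfl, hle⟩ := extend_evLE_some he'
    exact extend_locPred_some hO (hι'.2 e₀ hle) σ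

theorem card_filter_le_one_of_nodup_map {α κ : Type} (k : α → κ) (s : Multiset α)
    (hs : (s.map k).Nodup) (x : κ) : (s.filter fun a => k a = x).card ≤ 1 := by
  have := Multiset.nodup_iff_count_le_one.mp hs x
  rw [Multiset.count_map] at this
  simpa [eq_comm] using this

theorem extend_ordinary (hO : O.IsOccNet) (hw : (w.map Prod.fst).Nodup)
    (hpost : ((N.postFlow t).map Prod.fst).Nodup) : (extend O N t w).Ordinary := by
  have hinl : ∀ s : Multiset (O.Place × Var), (s.map Prod.fst).Nodup →
      ((s.map fun bv => ((Sum.inl bv.1, bv.2) : (extend O N t w).Place × Var)).map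
        Prod.fst).Nodup := by
    intro s hs
    have := hs.map (f := (Sum.inl : O.Place → (extend O N t w).Place)) Sum.inl_injective
    rw [Multiset.map_map] at this ⊢
    exact this
  constructor
  · rintro (_ | e) b
    · exact card_filter_le_one_of_nodup_map _ _ (hinl w hw) b
    · exact card_filter_le_one_of_nodup_map _ _ (hinl _ (hO.nodup_map_fst_preFlow e)) b
  · rintro (_ | e) b
    · refine card_filter_le_one_of_nodup_map _ _ ?_ b
      have : (N.postFlow t).attach.Nodup := Multiset.nodup_attach.mpr (Multiset.Nodup.of_map _ hpost)
      have := this.map (f := (Sum.inr : _ → (extend O N t w).Place)) Sum.inr_injective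
      simp only [extend, Multiset.map_map]
      exact this
    · exact card_filter_le_one_of_nodup_map _ _ (hinl _ (hO.nodup_map_fst_postFlow e)) b

theorem extend_not_self_conflict (hO : O.IsOccNet) {C : Set O.Trans} (hC : O.Closed C)
    (hcf : O.ConflictFree C) (hw : ∀ bv ∈ w, bv.1 ∈ O.cut C) (e : (extend O N t w).Trans) :
    ¬ (extend O N t w).SConflict (Sum.inr e) (Sum.inr e) := by
  rintro ⟨b | x, t₁, t₂, hne, ⟨v₁, hb₁⟩, ⟨v₂, hb₂⟩, h₁, h₂⟩
  swap
  · exact extend_inr_notMem_preFlow hb₁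
  rcases e with _ | e
  · have hmem : ∀ {e₀ : O.Trans}, (∃ bv ∈ w, O.cle (Sum.inr e₀) (Sum.inl bv.1)) → e₀ ∈ C := by
      rintro e₀ ⟨bv, hbv, hle⟩
      exact hC.mem_of_cle hO.uniqueInput (hw bv hbv).1 hle
    rcases extend_evLE_none h₁ with rfl | ⟨e₁, rfl, he₁⟩ <;>
      rcases extend_evLE_none h₂ with rfl | ⟨e₂, rfl, he₂⟩
    · exact hne rfl
    · exact (hw _ (extend_mem_preFlow_none.mp hb₁)).2
        ⟨e₂, hmem he₂, v₂, extend_mem_preFlow_some.mp hb₂⟩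
    · exact (hw _ (extend_mem_preFlow_none.mp hb₂)).2
        ⟨e₁, hmem he₁, v₁, extend_mem_preFlow_some.mp hb₁⟩
    · exact hne (congrArg some (hcf.eq_of_mem_pre (hmem he₁) (hmem he₂)
        ⟨v₁, extend_mem_preFlow_some.mp hb₁⟩ ⟨v₂, extend_mem_preFlow_some.mp hb₂⟩))
  · obtain ⟨e₁, rfl, he₁⟩ := extend_evLE_some h₁
    obtain ⟨e₂, rfl, he₂⟩ := extend_evLE_some h₂
    exact hO.not_self_conflict e ⟨b, e₁, e₂, fun h => hne (congrArg some h),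
      ⟨v₁, extend_mem_preFlow_some.mp hb₁⟩, ⟨v₂, extend_mem_preFlow_some.mp hb₂⟩, he₁, he₂⟩

theorem extend_isOccNet (hO : O.IsOccNet) {C : Set O.Trans} (hC : O.Closed C)
    (hcf : O.ConflictFree C) (hw : ∀ bv ∈ w, bv.1 ∈ O.cut C) (hwnd : (w.map Prod.fst).Nodup)
    (hpost : ((N.postFlow t).map Prod.fst).Nodup) : (extend O N t w).IsOccNet := by
  have hwf : WellFounded (extend O N t w).clt := extend_wellFounded hO
  have hfilter : ∀ (K : O.Marking) (b : O.Place),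
      ((K.map fun bc => ((Sum.inl bc.1, bc.2) : (extend O N t w).Place × Color)).filter
        fun bc => bc.1 = Sum.inl b).card = (K.filter fun bc => bc.1 = b).card := by
    intro K b
    rw [Multiset.filter_map, Multiset.card_map]
    congr 1
    exact Multiset.filter_congr fun bc _ => by simp
  refine ⟨⟨hO.wellFormed.1.image _, ?_⟩, extend_ordinary hO hwnd hpost,
    extend_not_self_conflict hO hC hcf hw, fun x hx => ?_, hwf, ?_⟩
  · rintro _ ⟨K, hK, rfl⟩ _ ⟨K', hK', rfl⟩
    have := congrArg (Multiset.map (Sum.inl : O.Place → (extend O N t w).Place))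
      (hO.wellFormed.2 K hK K' hK')
    rw [Multiset.map_map, Multiset.map_map] at this
    refine (Multiset.map_map Prod.fst _ K).trans (this.trans ?_)
    exact (Multiset.map_map Prod.fst (fun bc => (Sum.inl bc.1, bc.2)) K').symm
  · exact hwf.asymmetric x x hx hx
  · rintro (b | x)
    · rcases hO.2.2.2.2.2 b with ⟨h₁, h₂⟩ | ⟨⟨e, v, hv, h₁⟩, h₂⟩
      · left
        constructor
        · rintro (_ | e) v hv
          · exact extend_inl_notMem_postFlow_none hv
          · exact h₁ e v (extend_mem_postFlow_some.mp hv)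
        · rintro _ ⟨K, hK, rfl⟩
          exact (hfilter K b).trans (h₂ K hK)
      · right
        constructor
        · have hv' : (Sum.inl b, v) ∈ (extend O N t w).postFlow (some e) :=
            extend_mem_postFlow_some.mpr hv
          exact ⟨some e, v, hv', fun e' v' h' => extend_uniqueInput hO.uniqueInput _ _ _ _ _ hv' h'⟩
        · rintro _ ⟨K, hK, rfl⟩
          exact (hfilter K b).trans (h₂ K hK)
    · right
      constructor
      · have hv' : (Sum.inr x, x.1.2) ∈ (extend O N t w).postFlow none :=
          extend_mem_postFlow_none.mpr rfl
        exact ⟨none, x.1.2, hv', fun e' v' h' =>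
          extend_uniqueInput hO.uniqueInput _ _ _ _ _ hv' h'⟩
      · rintro _ ⟨K, hK, rfl⟩
        refine Multiset.card_eq_zero.mpr (Multiset.filter_eq_nil.mpr fun bc hbc => ?_)
        obtain ⟨bc', -, rfl⟩ := Multiset.mem_map.mp hbc
        exact Sum.inl_ne_inr

theorem extend_initial {h : Hom O N} (hi : h.Initial)
    (hw : N.preFlow t = w.map fun bv => (h.mapP bv.1, bv.2)) : (extendHom h t w hw).Initial := by
  unfold Hom.Initial at hi ⊢
  rw [← hi]
  simp only [extend, Set.image_image]
  refine Set.image_congr fun K _ => ?_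
  simp only [Hom.mapMarking, Multiset.map_map]
  rfl

theorem extend_isSBP {h : Hom O N} (hS : IsSBP h)
    (hw : N.preFlow t = w.map fun bv => (h.mapP bv.1, bv.2))
    {C : Set O.Trans} (hC : O.Closed C) (hcf : O.ConflictFree C)
    (hwC : ∀ bv ∈ w, bv.1 ∈ O.cut C) (hwnd : (w.map Prod.fst).Nodup)
    (hpost : ((N.postFlow t).map Prod.fst).Nodup) {ι : O.Assign}
    (hι : O.IsInst C ι) {σ : Var → Color} (hg : N.guard t σ)
    (hval : ∀ bv ∈ w, σ bv.2 = O.valOf ι bv.1)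
    (hnew : ∀ e, h.mapT e = t → O.preFlow e ≠ w) : IsSBP (extendHom h t w hw) := by
  have hinj : Function.Injective fun bv : O.Place × Var =>
      ((Sum.inl bv.1, bv.2) : (extend O N t w).Place × Var) := by
    rintro ⟨b, v⟩ ⟨b', v'⟩ hbv
    obtain ⟨h₁, h₂⟩ := Prod.mk.inj hbv
    exact Prod.ext (Sum.inl.inj h₁) h₂
  refine ⟨extend_isOccNet hS.isOccNet hC hcf hwC hwnd hpost, extend_initial hS.2.1 hw,
    extend_exists_pred hS.isOccNet.uniqueInput hS.2.2.1 hC hwC hι hg hval, ?_⟩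
  rintro (_ | e) (_ | e') hp ht
  · rfl
  · exact (hnew e' ht.symm (Multiset.map_injective hinj hp).symm).elim
  · exact (hnew e ht (Multiset.map_injective hinj hp)).elim
  · exact congrArg some (hS.2.2.2 e e' (Multiset.map_injective hinj hp) ht)

/-- A label-preserving initial homomorphism from an extension of a branching process back into it
fixes all original nodes. -/
theorem extend_prefix_fixes {h : Hom O N} (hS : IsSBP h) (hN : N.Safe)
    (hw : N.preFlow t = w.map fun bv => (h.mapP bv.1, bv.2)) (φ : Hom (extend O N t w) O)
    (hφi : φ.Initial) (hφP : ∀ b, h.mapP (φ.mapP b) = (extendHom h t w hw).mapP b)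
    (hφT : ∀ e, h.mapT (φ.mapT e) = (extendHom h t w hw).mapT e) (x : O.Node) :
    Sum.map φ.mapP φ.mapT (extendNode O N t w x) = x := by
  have hO := hS.isOccNet
  induction x using hO.wellFounded.induction with
  | _ x ih =>
    rcases x with b | e
    · refine congrArg Sum.inl ?_
      rcases mem_B0_or_exists_post b with hb | ⟨e, v, hv⟩
      · obtain ⟨K₀, hK₀⟩ := hO.wellFormed.1
        obtain ⟨c, hc⟩ := (hO.mem_B0_iff_exists_mem hK₀ b).mp hb
        refine hS.injOn_B0 hN ?_ hb (hφP (Sum.inl b))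
        have hmem : φ.mapMarking (K₀.map fun bc => (Sum.inl bc.1, bc.2)) ∈ O.init :=
          hφi ▸ ⟨_, ⟨K₀, hK₀, rfl⟩, rfl⟩
        rw [hO.mem_B0_iff_exists_mem hmem]
        refine ⟨c, Multiset.mem_map.mpr ⟨(Sum.inl b, c), ?_, rfl⟩⟩
        exact Multiset.mem_map.mpr ⟨(b, c), hc, rfl⟩
      · have he : φ.mapT (some e) = e :=
          Sum.inr.inj (ih (Sum.inr e) (Relation.TransGen.single ⟨v, hv⟩))
        refine hS.injOn_post hN e ⟨v, ?_⟩ ⟨v, hv⟩ (hφP (Sum.inl b))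
        have hpost := φ.post_eq (some e)
        rw [he] at hpost
        rw [hpost]
        exact Multiset.mem_map.mpr ⟨_, extend_mem_postFlow_some.mpr hv, rfl⟩
    · refine congrArg Sum.inr (hS.2.2.2 _ _ ?_ (hφT (some e)))
      have hpre := φ.pre_eq (some e)
      refine hpre.trans ?_
      simp only [extend, Multiset.map_map]
      conv_rhs => rw [← Multiset.map_id (O.preFlow e)]
      refine Multiset.map_congr rfl fun bv hbv => ?_
      exact Prod.ext (Sum.inl.inj (ih (Sum.inl bv.1) (Relation.TransGen.single ⟨bv.2, hbv⟩))) rfl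

/-- In the unfolding, every possible extension of a configuration is present. -/
theorem IsUnfolding.exists_event {h : Hom O N} (hU : IsUnfolding h) (hN : N.Safe)
    (hw : N.preFlow t = w.map fun bv => (h.mapP bv.1, bv.2))
    {C : Set O.Trans} (hC : O.Closed C) (hcf : O.ConflictFree C)
    (hwC : ∀ bv ∈ w, bv.1 ∈ O.cut C) (hwnd : (w.map Prod.fst).Nodup)
    (hpost : ((N.postFlow t).map Prod.fst).Nodup) {ι : O.Assign}
    (hι : O.IsInst C ι) {σ : Var → Color} (hg : N.guard t σ)
    (hval : ∀ bv ∈ w, σ bv.2 = O.valOf ι bv.1) :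
    ∃ e, h.mapT e = t ∧ O.preFlow e = w := by
  by_contra! hnew
  obtain ⟨φ, hφi, -, -, hφP, hφT⟩ := hU.2 _ _
    (extend_isSBP hU.1 hw hC hcf hwC hwnd hpost hι hg hval hnew)
  refine hnew (φ.mapT none) (hφT none) ?_
  have hpre := φ.pre_eq none
  refine hpre.trans ?_
  simp only [extend, Multiset.map_map]
  conv_rhs => rw [← Multiset.map_id w]
  refine Multiset.map_congr rfl fun bv _ => ?_
  exact Prod.ext (Sum.inl.inj (extend_prefix_fixes hU.1 hN hw φ hφi hφP hφT (Sum.inl bv.1))) rfl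

end Extension

variable {O N : HLNet Color Var}

/-- Every firing from the marking of an instantiated configuration is represented by an event
enabled in its cut. -/
theorem IsUnfolding.exists_event_of_fires {h : Hom O N} (hU : IsUnfolding h) (hN : N.Safe)
    {C : Set O.Trans} (hC : O.FinCfg C) {ι : O.Assign} (hι : O.IsInst C ι)
    (hfin : (O.cut C).Finite) {t : N.Trans} {σ : Var → Color}
    (hf : N.fires (mark h hfin ι) t σ) :
    ∃ e, h.mapT e = t ∧ O.pre e ⊆ O.cut C ∧ ∀ bv ∈ O.preFlow e, σ bv.2 = O.valOf ι bv.1 := by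
  have hM := reach_mark hU.1 hC hι hfin
  obtain ⟨u, hu, hmap⟩ := exists_le_map_eq _ _ _ hf.2
  obtain ⟨w, hw, hwu, hval⟩ : ∃ w : Multiset (O.Place × Var),
      N.preFlow t = w.map (fun bv => (h.mapP bv.1, bv.2)) ∧ w.map Prod.fst = u ∧
        ∀ bv ∈ w, σ bv.2 = O.valOf ι bv.1 := by
    rcases (N.preFlow t).empty_or_exists_mem with h₀ | ⟨pv₀, hpv₀⟩
    · have : u = 0 := by simpa [preMark, h₀] using hmap
      exact ⟨0, by simp [h₀], by simp [this], by simp⟩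
    · have hmem : (pv₀.1, σ pv₀.2) ∈ u.map fun b => (h.mapP b, O.valOf ι b) := by
        rw [hmap]
        exact Multiset.mem_map_of_mem _ hpv₀
      obtain ⟨b₀, -, -⟩ := Multiset.mem_map.mp hmem
      obtain ⟨f, h₁, h₂⟩ := exists_matching_of_map_eq (fun _ => b₀) Prod.fst
        (fun pv : N.Place × Var => (pv.1, σ pv.2)) (fun b => (h.mapP b, O.valOf ι b))
        (N.preFlow t) u (hN.nodup_preFlow hM hf) hmap.symm
      refine ⟨(N.preFlow t).map fun pv => (f pv.1, pv.2), ?_, ?_, ?_⟩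
      · rw [Multiset.map_map]
        conv_lhs => rw [← Multiset.map_id (N.preFlow t)]
        exact Multiset.map_congr rfl fun pv hpv =>
          Prod.ext (Prod.mk.inj (h₂ pv hpv)).1.symm rfl
      · rw [Multiset.map_map]
        exact h₁.symm
      · rintro bv hbv
        obtain ⟨pv, hpv, rfl⟩ := Multiset.mem_map.mp hbv
        exact (Prod.mk.inj (h₂ pv hpv)).2.symm
  have hwC : ∀ bv ∈ w, bv.1 ∈ O.cut C := fun bv hbv => by
    have := Multiset.mem_of_le hu (hwu ▸ Multiset.mem_map_of_mem Prod.fst hbv)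
    simpa using this
  obtain ⟨e, he, hpre⟩ := hU.exists_event hN hw hC.1.closed hC.1.conflictFree hwC
    (hwu ▸ Multiset.nodup_of_le hu hfin.toFinset.nodup) (hN.nodup_postFlow hM hf) hι hf.1 hval
  refine ⟨e, he, ?_, hpre ▸ hval⟩
  rintro b ⟨v, hb⟩
  exact hwC (b, v) (hpre ▸ hb)

/-- Every initial cut of a branching process is chosen by some assignment. -/
theorem IsSBP.exists_assign_of_mem_init {h : Hom O N} (hS : IsSBP h) {K : O.Marking}
    (hK : K ∈ O.init) : ∃ ι : O.Assign, ∀ b c, (b, c) ∈ K → ι (Sum.inr b) = c := by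
  have hO := hS.isOccNet
  have hnd : (K.map Prod.fst).Nodup := by
    rw [Multiset.nodup_iff_count_le_one]
    intro b
    rw [hO.count_map_fst hK]
    split <;> simp
  have : ∀ x : (O.Trans × Var) ⊕ O.Place, ∃ c, ∀ b, x = Sum.inr b → ∀ c', (b, c') ∈ K → c = c' := by
    rintro (⟨e, v⟩ | b)
    · obtain ⟨ι, -⟩ := hS.2.2.1 e
      exact ⟨ι (Sum.inl (e, v)), fun b hb => by cases hb⟩
    · by_cases hb : ∃ c, (b, c) ∈ K
      · obtain ⟨c, hc⟩ := hb
        refine ⟨c, fun b' hb' c' hc' => ?_⟩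
        cases hb'
        exact (Prod.mk.inj (map_injOn_of_nodup_map _ _ hnd hc hc' rfl)).2
      · rcases mem_B0_or_exists_post b with hb' | ⟨e, -⟩
        · exact (hb ((hO.mem_B0_iff_exists_mem hK b).mp hb')).elim
        · obtain ⟨ι, -⟩ := hS.2.2.1 e
          refine ⟨ι (Sum.inr b), fun b' hb' c' hc' => ?_⟩
          cases hb'
          exact (hb ⟨c', hc'⟩).elim
  choose ι hι using this
  exact ⟨ι, fun b c hbc => hι _ b rfl c hbc⟩

theorem finCfg_empty {ι : O.Assign} (hι : O.predBot ι) : O.FinCfg ∅ :=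
  ⟨⟨fun _ h => h.elim, fun _ h => h.elim, ι, hι, fun _ h => h.elim⟩, Set.finite_empty⟩

theorem IsSBP.mem_marks_empty {h : Hom O N} (hS : IsSBP h) {M : N.Marking} (hM : M ∈ N.init) :
    O.FinCfg ∅ ∧ M ∈ marks h ∅ := by
  have hO := hS.isOccNet
  rw [← hS.2.1] at hM
  obtain ⟨K, hK, rfl⟩ := hM
  obtain ⟨ι, hι⟩ := hS.exists_assign_of_mem_init hK
  have hbot : O.predBot ι := ⟨K, hK, hι⟩
  have hfin := hO.cut_finite (C := ∅) Set.finite_empty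
  refine ⟨finCfg_empty hbot, ι, ⟨hbot, fun _ h => h.elim⟩, hfin, ?_⟩
  rw [← hO.init_eq hK hfin hι, Hom.mapMarking, Multiset.map_map]
  rfl

theorem ReachSteps.reach {k : ℕ} : ∀ {M : N.Marking}, N.ReachSteps k M → N.Reach M := by
  induction k with
  | zero => exact fun h => Reach.init h
  | succ k ih =>
    rintro M ⟨M', t, σ, h, hf⟩
    exact Reach.step (ih h) hf

/-- A marking reached by `k` firings is represented by a configuration of at most `k` events. -/
theorem IsUnfolding.exists_finCfg_of_reachSteps {h : Hom O N} (hU : IsUnfolding h) (hN : N.Safe)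
    {k : ℕ} : ∀ {M : N.Marking}, N.ReachSteps k M →
      ∃ C, O.FinCfg C ∧ C.ncard ≤ k ∧ M ∈ marks h C := by
  have hO := hU.1.isOccNet
  induction k with
  | zero =>
    intro M hM
    obtain ⟨h₁, h₂⟩ := hU.1.mem_marks_empty hM
    exact ⟨∅, h₁, by simp, h₂⟩
  | succ k ih =>
    rintro M' ⟨M, t, σ, hM, hf, rfl⟩
    obtain ⟨C, hC, hk, ι, hι, hfin, rfl⟩ := ih hM
    obtain ⟨e, rfl, hpre, hval⟩ := hU.exists_event_of_fires hN hC hι hfin hf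
    by_cases he : e ∈ C
    · have h₀ : O.preFlow e = 0 := by
        refine Multiset.eq_zero_of_forall_notMem fun bv hbv => ?_
        exact (hpre ⟨bv.2, hbv⟩).2 ⟨e, he, bv.2, hbv⟩
      have h₁ : N.preFlow (h.mapT e) = 0 := by rw [h.pre_eq, h₀, Multiset.map_zero]
      have h₂ := hN.postFlow_eq_zero hM.reach hf h₁
      refine ⟨C, hC, hk.trans k.le_succ, ι, hι, hfin, ?_⟩
      simp [preMark, postMark, h₁, h₂]
    · have hg : O.guard e σ := (h.guard_iff e σ).mpr hf.1
      have hι' := hι.setMode hO hC.1.closed he hpre hg hval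
      have hC' := hC.insert hO hι he hpre hg hval
      have hfin' := hO.cut_finite hC'.2
      refine ⟨insert e C, hC', ?_, ι.setMode e σ, hι', hfin', ?_⟩
      · exact (Set.ncard_insert_le _ _).trans (Nat.succ_le_succ hk)
      · have hstep := (mark_firesTo hO h hC.1.closed he hpre
          (((isInst_iff hC'.1.closed).mp hι').2 e (Set.mem_insert _ _)) hfin hfin').2
        have hmode : (fun v => ι.setMode e σ (Sum.inl (e, v))) = σ := by
          funext v
          simp [Assign.setMode]
        rw [hmode] at hstep
        rw [hstep, mark_congr h rfl hfin hfin (ι := ι.setMode e σ) (ι' := ι)]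
        exact fun b hb => valOf_setMode_of_notMem hO.uniqueInput ι σ (hO.notMem_post he hb.1)

theorem finite_setOf_nodup_subset {α : Type} {S : Set α} (hS : S.Finite) :
    {s : Multiset α | s.Nodup ∧ ∀ a ∈ s, a ∈ S}.Finite := by
  refine (hS.toFinset.powerset.finite_toSet.image Finset.val).subset ?_
  rintro s ⟨hs, hsS⟩
  refine ⟨⟨s, hs⟩, ?_, rfl⟩
  simp only [Finset.coe_powerset, Set.mem_preimage, Set.mem_powerset_iff]
  intro a ha
  simpa using hsS a ha

/-- Only finitely many events have their preset inside a given finite set of conditions. -/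
theorem IsSBP.finite_setOf_pre_subset {h : Hom O N} (hS : IsSBP h) (hN : N.NetFinite)
    {B : Set O.Place} (hB : B.Finite) : {e | O.pre e ⊆ B}.Finite := by
  have : Finite N.Trans := hN.2
  let V : Set Var := ⋃ t : N.Trans, {v | v ∈ (N.preFlow t).map Prod.snd}
  have hV : V.Finite := Set.finite_iUnion fun t =>
    ((N.preFlow t).map Prod.snd).toFinset.finite_toSet.subset fun v hv => by simpa using hv
  refine Set.Finite.of_finite_image (f := fun e => (h.mapT e, O.preFlow e)) ?_ ?_
  · refine (Set.finite_univ.prod (finite_setOf_nodup_subset (hB.prod hV))).subset ?_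
    rintro _ ⟨e, he, rfl⟩
    refine ⟨Set.mem_univ _, (hS.isOccNet.nodup_map_fst_preFlow e).of_map, fun bv hbv => ?_⟩
    refine ⟨he ⟨bv.2, hbv⟩, Set.mem_iUnion.mpr ⟨h.mapT e, ?_⟩⟩
    rw [h.pre_eq]
    simp only [Multiset.map_map, Set.mem_ofPred_eq]
    exact Multiset.mem_map_of_mem _ hbv
  · intro e _ e' _ heq
    exact hS.2.2.2 e e' (Prod.mk.inj heq).2 (Prod.mk.inj heq).1

/-- The preset of an event consists of initial conditions and of conditions produced by strict
causal predecessors. -/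
theorem exists_evLE_of_mem_pre (hO : O.IsOccNet) {e : O.Trans} {b : O.Place} (hb : b ∈ O.pre e) :
    b ∈ O.B0 ∨ ∃ e' ∈ O.cone e, e' ≠ e ∧ b ∈ O.post e' := by
  refine (mem_B0_or_exists_post b).imp_right ?_
  rintro ⟨e', he'⟩
  refine ⟨e', evLE_of_post_pre he' hb, ?_, he'⟩
  rintro rfl
  exact hO.notMem_pre_of_mem_post he' hb

theorem IsOccNet.cone_ssubset (hO : O.IsOccNet) {e e' : O.Trans} (h : e' ∈ O.cone e)
    (hne : e' ≠ e) : O.cone e' ⊂ O.cone e := by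
  refine ⟨cone_subset (closed_cone e) h, fun hsub => hne ?_⟩
  exact hO.evLE_antisymm h (hsub (mem_cone_self e))

theorem IsSBP.finite_setOf_ncard_cone_le {h : Hom O N} (hS : IsSBP h) (hN : N.NetFinite) (k : ℕ) :
    {e | (O.cone e).ncard ≤ k}.Finite := by
  have hO := hS.isOccNet
  induction k with
  | zero =>
    refine Set.finite_empty.subset fun e he => ?_
    have := (Set.ncard_eq_zero (hO.cone_finite e)).mp (Nat.le_zero.mp he)
    exact this ▸ mem_cone_self e
  | succ k ih =>
    refine (hS.finite_setOf_pre_subset hN (hO.B0_finite.union (postConds_finite ih))).subset ?_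
    intro e he b hb
    refine (exists_evLE_of_mem_pre hO hb).imp_right ?_
    rintro ⟨e', he', hne, hb'⟩
    refine ⟨e', ?_, hb'⟩
    have := Set.ncard_lt_ncard (hO.cone_ssubset he' hne) (hO.cone_finite e)
    exact Nat.le_of_lt_succ (this.trans_le he)

/-- The cones of non-cut-off events are bounded by the reachability bound. -/
theorem IsUnfolding.ncard_cone_le {h : Hom O N} (hU : IsUnfolding h) (hN : N.Safe) {n : ℕ}
    (hn : N.BoundedReach n) {r : Set O.Trans → Set O.Trans → Prop}
    (hsz : ∀ C1 C2, O.FinCfg C1 → O.FinCfg C2 → C1.ncard < C2.ncard → r C1 C2) {e : O.Trans}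
    (he : ¬ IsCutoffStar h r e) : (O.cone e).ncard ≤ n := by
  by_contra! hlt
  refine he ?_
  rintro M ⟨ι, hι, hfin, rfl⟩
  obtain ⟨k, hk, hM⟩ := hn _ (reach_mark hU.1 (hU.1.finCfg_cone e) hι hfin)
  obtain ⟨C, hC, hCk, hMC⟩ := hU.exists_finCfg_of_reachSteps hN hM
  exact ⟨C, hC, hsz C _ hC (hU.1.finCfg_cone e) ((hCk.trans hk).trans_lt hlt), hMC⟩

theorem IsUnfolding.finEventsStar_finite {h : Hom O N} (hU : IsUnfolding h) (hN : N.Safe)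
    (hfin : N.NetFinite) {n : ℕ} (hn : N.BoundedReach n) {r : Set O.Trans → Set O.Trans → Prop}
    (hsz : ∀ C1 C2, O.FinCfg C1 → O.FinCfg C2 → C1.ncard < C2.ncard → r C1 C2) :
    (finEventsStar h r).Finite := by
  have hO := hU.1.isOccNet
  refine (hU.1.finite_setOf_pre_subset hfin (hO.B0_finite.union
    (postConds_finite (hU.1.finite_setOf_ncard_cone_le hfin n)))).subset ?_
  intro e he b hb
  refine (exists_evLE_of_mem_pre hO hb).imp_right ?_
  rintro ⟨e', he', hne, hb'⟩
  exact ⟨e', hU.ncard_cone_le hN hn hsz (he e' he' hne), hb'⟩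

theorem mark_eq_of_image (h : Hom O N) {C C' : Set O.Trans} {f : O.Place → O.Place}
    (hinj : Set.InjOn f (O.cut C)) (him : f '' O.cut C = O.cut C')
    (hP : ∀ b ∈ O.cut C, h.mapP (f b) = h.mapP b) {ι ι' : O.Assign}
    (hv : ∀ b ∈ O.cut C, O.valOf ι' (f b) = O.valOf ι b)
    (hfin : (O.cut C).Finite) (hfin' : (O.cut C').Finite) : mark h hfin ι = mark h hfin' ι' := by
  have hval : hfin'.toFinset.val = hfin.toFinset.val.map f := by
    have : hfin'.toFinset = hfin.toFinset.image f := by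
      ext b
      simp [← him]
    rw [this]
    exact Finset.image_val_of_injOn (by simpa using hinj)
  unfold mark
  rw [hval, Multiset.map_map]
  refine Multiset.map_congr rfl fun b hb => ?_
  have hb' : b ∈ O.cut C := by simpa using hb
  exact Prod.ext (hP b hb').symm (hv b hb').symm

theorem cut_subset_cut_union_postConds {C₁ C : Set O.Trans} (hsub : C₁ ⊆ C) :
    O.cut C ⊆ O.cut C₁ ∪ O.postConds (C \ C₁) := by
  rintro b ⟨hb, hpre⟩
  have hpre₁ : b ∉ O.preConds C₁ := fun ⟨e, he, hb⟩ => hpre ⟨e, hsub he, hb⟩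
  rcases hb with hb | ⟨e, he, hb⟩
  · exact Or.inl ⟨Or.inl hb, hpre₁⟩
  · by_cases he₁ : e ∈ C₁
    · exact Or.inl ⟨Or.inr ⟨e, he₁, hb⟩, hpre₁⟩
    · exact Or.inr ⟨e, ⟨he, he₁⟩, hb⟩

theorem cut_union_postConds_subset {C₁ C : Set O.Trans} (hsub : C₁ ⊆ C) :
    O.cut C₁ ∪ O.postConds (C \ C₁) ⊆ O.B0 ∪ O.postConds C := by
  rintro b (⟨hb | ⟨e, he, hb⟩, -⟩ | ⟨e, he, hb⟩)
  · exact Or.inl hb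
  · exact Or.inr ⟨e, hsub he, hb⟩
  · exact Or.inr ⟨e, he.1, hb⟩

theorem preConds_sdiff_subset {C₁ C : Set O.Trans} (hsub : C₁ ⊆ C) (hC : O.Closed C)
    (hcf : O.ConflictFree C) : O.preConds (C \ C₁) ⊆ O.cut C₁ ∪ O.postConds (C \ C₁) := by
  rintro b ⟨d, hd, hb⟩
  have hpre₁ : b ∉ O.preConds C₁ := fun ⟨e, he, hb'⟩ =>
    hd.2 (hcf.eq_of_mem_pre (hsub he) hd.1 hb' hb ▸ he)
  rcases mem_B0_or_exists_post b with hb' | ⟨e, hb'⟩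
  · exact Or.inl ⟨Or.inl hb', hpre₁⟩
  · by_cases he₁ : e ∈ C₁
    · exact Or.inl ⟨Or.inr ⟨e, he₁, hb'⟩, hpre₁⟩
    · exact Or.inr ⟨e, ⟨hC d hd.1 e (evLE_of_post_pre hb' hb), he₁⟩, hb'⟩

/-- The part `C \ C₁` of a configuration is replayed after the configuration `C₂` as `D₂`, along
the maps `f` on conditions and `g` on events. -/
structure Replay (h : Hom O N) (C₁ C₂ C : Set O.Trans) (ι₁ ι₂ : O.Assign) (D₂ : Set O.Trans)
    (f : O.Place → O.Place) (g : O.Trans → O.Trans) : Prop where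
  injP : Set.InjOn f (O.cut C₁ ∪ O.postConds (C \ C₁))
  image_cut : f '' O.cut C₁ = O.cut C₂
  image_cut' : f '' O.cut C = O.cut (C₂ ∪ D₂)
  injT : Set.InjOn g (C \ C₁)
  image : g '' (C \ C₁) = D₂
  mapP : ∀ b ∈ O.cut C₁ ∪ O.postConds (C \ C₁), h.mapP (f b) = h.mapP b
  mapT : ∀ d ∈ C \ C₁, h.mapT (g d) = h.mapT d
  preFlow : ∀ d ∈ C \ C₁, O.preFlow (g d) = (O.preFlow d).map fun bv => (f bv.1, bv.2)
  postFlow : ∀ d ∈ C \ C₁, O.postFlow (g d) = (O.postFlow d).map fun bv => (f bv.1, bv.2)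
  disjoint : Disjoint C₂ D₂
  finCfg : O.FinCfg (C₂ ∪ D₂)
  isInst : O.IsInst (C₂ ∪ D₂) ι₂
  valOf : ∀ b ∈ O.cut C₁ ∪ O.postConds (C \ C₁), O.valOf ι₂ (f b) = O.valOf ι₁ b

/-- Configurations representing the same marking have cuts in label-preserving bijection. -/
theorem exists_replay_self (h : Hom O N) {C₁ C₂ : Set O.Trans} {ι₁ ι₂ : O.Assign}
    (hC₂ : O.FinCfg C₂) (hι₂ : O.IsInst C₂ ι₂) (hfin₁ : (O.cut C₁).Finite)
    (hfin₂ : (O.cut C₂).Finite) (hM : mark h hfin₁ ι₁ = mark h hfin₂ ι₂) :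
    ∃ f, Replay h C₁ C₂ C₁ ι₁ ι₂ ∅ f id := by
  obtain ⟨f, hf, hfv⟩ := exists_matching_of_map_eq (id : O.Place → O.Place) id
    (fun b => (h.mapP b, O.valOf ι₁ b)) (fun b => (h.mapP b, O.valOf ι₂ b))
    hfin₁.toFinset.val hfin₂.toFinset.val (by simp [hfin₁.toFinset.nodup]) hM
  simp only [id] at hf hfv
  have hfv' : ∀ b ∈ O.cut C₁, h.mapP (f b) = h.mapP b ∧ O.valOf ι₂ (f b) = O.valOf ι₁ b :=
    fun b hb => Prod.mk.inj (hfv b (by simpa using hb))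
  have hinj : Set.InjOn f (O.cut C₁) := by
    intro b hb b' hb' hbb
    refine Multiset.inj_on_of_nodup_map (hf ▸ hfin₂.toFinset.nodup) b ?_ b' ?_ hbb
    · simpa using hb
    · simpa using hb'
  have him : f '' O.cut C₁ = O.cut C₂ := by
    ext b
    have : b ∈ hfin₂.toFinset.val ↔ b ∈ hfin₁.toFinset.val.map f := by rw [hf]
    simpa [eq_comm] using this.symm
  have hd : C₁ \ C₁ = ∅ := Set.sdiff_self
  have hp : O.postConds (∅ : Set O.Trans) = ∅ := by
    ext b
    simp [postConds]
  have hA : O.cut C₁ ∪ O.postConds (C₁ \ C₁) = O.cut C₁ := by rw [hd, hp, Set.union_empty]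
  have hD : ∀ d, d ∉ C₁ \ C₁ := fun d hd => hd.2 hd.1
  exact ⟨f, {
    injP := by rwa [hA]
    image_cut := him
    image_cut' := by rw [him, Set.union_empty]
    injT := fun _ h => (hD _ h).elim
    image := by rw [hd, Set.image_empty]
    mapP := by rw [hA]; exact fun b hb => (hfv' b hb).1
    mapT := fun d h => (hD d h).elim
    preFlow := fun d h => (hD d h).elim
    postFlow := fun d h => (hD d h).elim
    disjoint := Set.disjoint_empty _
    finCfg := by rwa [Set.union_empty]
    isInst := by rwa [Set.union_empty]
    valOf := by rw [hA]; exact fun b hb => (hfv' b hb).2 }⟩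

/-- A replay is extended by one further event. -/
theorem Replay.exists_insert {h : Hom O N} (hU : IsUnfolding h) (hN : N.Safe)
    {C₁ C₂ C : Set O.Trans} {ι₁ ι₂ : O.Assign} {D₂ : Set O.Trans} {f : O.Place → O.Place}
    {g : O.Trans → O.Trans} (R : Replay h C₁ C₂ C ι₁ ι₂ D₂ f g) (hsub : C₁ ⊆ C)
    (hC : O.Closed C) (hcf : O.ConflictFree C) {e : O.Trans} (he : e ∉ C) (hpre : O.pre e ⊆ O.cut C)
    (hloc : O.locPred e ι₁) (hne : O.preFlow e ≠ 0) :
    ∃ ι₂ D₂ f g, Replay h C₁ C₂ (insert e C) ι₁ ι₂ D₂ f g := by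
  have hO := hU.1.isOccNet
  have hcutA := cut_subset_cut_union_postConds (O := O) hsub
  have hAC := cut_union_postConds_subset (O := O) hsub
  have hdiff : insert e C \ C₁ = insert e (C \ C₁) :=
    Set.insert_sdiff_of_notMem _ fun h => he (hsub h)
  set A := O.cut C₁ ∪ O.postConds (C \ C₁) with hAdef
  have hpreA : ∀ bv ∈ O.preFlow e, bv.1 ∈ A := fun bv hbv => hcutA (hpre ⟨bv.2, hbv⟩)
  have hA' : O.cut C₁ ∪ O.postConds (insert e C \ C₁) = A ∪ O.post e := by
    rw [hdiff, postConds_insert, hAdef, Set.union_comm (O.post e), Set.union_assoc]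
  let w : Multiset (O.Place × Var) := (O.preFlow e).map fun bv => (f bv.1, bv.2)
  have hw : N.preFlow (h.mapT e) = w.map fun bv => (h.mapP bv.1, bv.2) := by
    rw [h.pre_eq, Multiset.map_map]
    exact Multiset.map_congr rfl fun bv hbv => Prod.ext (R.mapP _ (hpreA bv hbv)).symm rfl
  have hwC : ∀ bv ∈ w, bv.1 ∈ O.cut (C₂ ∪ D₂) := by
    intro bv' hbv'
    obtain ⟨bv, hbv, rfl⟩ := Multiset.mem_map.mp hbv'
    exact R.image_cut' ▸ Set.mem_image_of_mem f (hpre ⟨bv.2, hbv⟩)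
  have hwnd : (w.map Prod.fst).Nodup := by
    have : w.map Prod.fst = ((O.preFlow e).map Prod.fst).map f := by
      simp only [w, Multiset.map_map]
      rfl
    rw [this]
    refine Multiset.Nodup.map_on (fun b hb b' hb' hbb => ?_) (hO.nodup_map_fst_preFlow e)
    exact R.injP (hcutA (hpre (mem_map_fst_preFlow.mp hb)))
      (hcutA (hpre (mem_map_fst_preFlow.mp hb'))) hbb
  let σ : Var → Color := fun v => ι₁ (Sum.inl (e, v))
  have hval : ∀ bv ∈ w, σ bv.2 = O.valOf ι₂ bv.1 := by
    intro bv' hbv'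
    obtain ⟨bv, hbv, rfl⟩ := Multiset.mem_map.mp hbv'
    exact (hloc.2 bv hbv).trans (R.valOf _ (hpreA bv hbv)).symm
  have hgN : N.guard (h.mapT e) σ := (h.guard_iff e σ).mp hloc.1
  obtain ⟨e₂, hT, hpre₂⟩ := hU.exists_event hN hw R.finCfg.1.closed R.finCfg.1.conflictFree hwC
    hwnd (hU.1.nodup_postFlow hN e) R.isInst hgN hval
  have hpre₂C : O.pre e₂ ⊆ O.cut (C₂ ∪ D₂) := by
    rintro b ⟨v, hb⟩
    exact hwC (b, v) (hpre₂ ▸ hb)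
  obtain ⟨bv₀, hbv₀⟩ := Multiset.exists_mem_of_ne_zero hne
  have hb₀ : (f bv₀.1, bv₀.2) ∈ O.preFlow e₂ := hpre₂ ▸ Multiset.mem_map_of_mem _ hbv₀
  have he₂ : e₂ ∉ C₂ ∪ D₂ := fun h => (hpre₂C ⟨_, hb₀⟩).2 ⟨e₂, h, _, hb₀⟩
  have hg₂ : O.guard e₂ σ := (h.guard_iff e₂ σ).mpr (hT ▸ hgN)
  have hfin := R.finCfg.insert hO R.isInst he₂ hpre₂C hg₂ (hpre₂ ▸ hval)
  have hinst := R.isInst.setMode hO R.finCfg.1.closed he₂ hpre₂C hg₂ (hpre₂ ▸ hval)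
  have hpost : (O.postFlow e).map (fun bv => (h.mapP bv.1, bv.2)) =
      (O.postFlow e₂).map fun bv => (h.mapP bv.1, bv.2) := by
    rw [← h.post_eq, ← h.post_eq, hT]
  obtain ⟨q, hq, hqv⟩ := exists_matching_of_map_eq (fun x : O.Place => (x, bv₀.2)) Prod.fst
    _ _ _ _ (hO.nodup_map_fst_postFlow e) hpost
  have hq₂ : ∀ bv ∈ O.postFlow e, q bv.1 = ((q bv.1).1, bv.2) := fun bv hbv =>
    Prod.ext rfl (Prod.mk.inj (hqv bv hbv)).2
  let f' : O.Place → O.Place := fun b => if b ∈ O.post e then (q b).1 else f b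
  let g' : O.Trans → O.Trans := fun d => if d = e then e₂ else g d
  have hAe : ∀ b ∈ A, b ∉ O.post e := fun b hb => hO.notMem_post he (hAC hb)
  have hf'A : ∀ b ∈ A, f' b = f b := fun b hb => if_neg (hAe b hb)
  have hf'e : ∀ b ∈ O.post e, f' b = (q b).1 := fun b hb => if_pos hb
  have hg'e : g' e = e₂ := if_pos rfl
  have hg'D : ∀ d ∈ C \ C₁, g' d = g d := fun d hd => if_neg (by rintro rfl; exact he hd.1)
  have hpostf : O.postFlow e₂ = (O.postFlow e).map fun bv => (f' bv.1, bv.2) := by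
    rw [hq]
    refine Multiset.map_congr rfl fun bv hbv => ?_
    rw [hf'e _ ⟨bv.2, hbv⟩]
    exact hq₂ bv hbv
  have hpref : O.preFlow e₂ = (O.preFlow e).map fun bv => (f' bv.1, bv.2) := by
    rw [hpre₂]
    refine Multiset.map_congr rfl fun bv hbv => ?_
    rw [hf'A _ (hpreA bv hbv)]
  have hfpost : f' '' O.post e = O.post e₂ := by
    ext b
    constructor
    · rintro ⟨b, ⟨v, hb⟩, rfl⟩
      exact ⟨v, hpostf ▸ Multiset.mem_map_of_mem (fun bv => (f' bv.1, bv.2)) hb⟩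
    · rintro ⟨v, hb⟩
      rw [hpostf] at hb
      obtain ⟨bv, hbv, heq⟩ := Multiset.mem_map.mp hb
      exact ⟨bv.1, ⟨bv.2, hbv⟩, (Prod.mk.inj heq).1⟩
  have hfpre : f '' O.pre e = O.pre e₂ := by
    ext b
    constructor
    · rintro ⟨b, ⟨v, hb⟩, rfl⟩
      exact ⟨v, hpre₂ ▸ Multiset.mem_map_of_mem (fun bv => (f bv.1, bv.2)) hb⟩
    · rintro ⟨v, hb⟩
      rw [hpre₂] at hb
      obtain ⟨bv, hbv, heq⟩ := Multiset.mem_map.mp hb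
      exact ⟨bv.1, ⟨bv.2, hbv⟩, (Prod.mk.inj heq).1⟩
  have hfA : ∀ b ∈ A, f b ∈ O.B0 ∪ O.postConds (C₂ ∪ D₂) := by
    rintro b (hb | ⟨d, hd, v, hb⟩)
    · have : f b ∈ O.cut C₂ := R.image_cut ▸ Set.mem_image_of_mem f hb
      exact this.1.imp_right fun ⟨d, hd, hb⟩ => ⟨d, Or.inl hd, hb⟩
    · refine Or.inr ⟨g d, Or.inr (R.image ▸ Set.mem_image_of_mem g hd), v, ?_⟩
      rw [R.postFlow d hd]
      exact Multiset.mem_map_of_mem (fun bv => (f bv.1, bv.2)) hb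
  have hfAe : ∀ b ∈ A, f b ∉ O.post e₂ := fun b hb => hO.notMem_post he₂ (hfA b hb)
  have hinjpost : Set.InjOn f' (O.post e) := by
    have hnd := hO.nodup_map_fst_postFlow e₂
    have : (O.postFlow e₂).map Prod.fst = ((O.postFlow e).map Prod.fst).map f' := by
      rw [hpostf, Multiset.map_map, Multiset.map_map]
      rfl
    rw [this] at hnd
    exact fun b hb b' hb' hbb => Multiset.inj_on_of_nodup_map hnd b (mem_map_fst_postFlow.mpr hb) b'
      (mem_map_fst_postFlow.mpr hb') hbb
  have hunion : C₂ ∪ insert e₂ D₂ = insert e₂ (C₂ ∪ D₂) := Set.union_insert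
  refine ⟨ι₂.setMode e₂ σ, insert e₂ D₂, f', g', ?_⟩
  exact {
    injP := by
      rw [hA', Set.injOn_union (Set.disjoint_left.mpr hAe)]
      refine ⟨R.injP.congr fun b hb => (hf'A b hb).symm, hinjpost, fun b hb b' hb' hbb => ?_⟩
      refine hfAe b hb ?_
      rw [← hf'A b hb, hbb, ← hfpost]
      exact Set.mem_image_of_mem f' hb'
    image_cut := by
      rw [← R.image_cut]
      exact Set.image_congr fun b hb => hf'A b (Or.inl hb)
    image_cut' := by
      rw [cut_insert hO hC he, hunion, cut_insert hO R.finCfg.1.closed he₂, Set.image_union, hfpost,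
        ← R.image_cut', ← hfpre]
      congr 1
      rw [Set.image_congr (g := f) fun b hb => hf'A b (hcutA hb.1)]
      ext b
      constructor
      · rintro ⟨b, hb, rfl⟩
        refine ⟨⟨b, hb.1, rfl⟩, ?_⟩
        rintro ⟨b', hb', hbb⟩
        exact hb.2 (R.injP (hcutA (hpre hb')) (hcutA hb.1) hbb ▸ hb')
      · rintro ⟨⟨b, hb, rfl⟩, hb'⟩
        exact ⟨b, ⟨hb, fun h => hb' ⟨b, h, rfl⟩⟩, rfl⟩
    injT := by
      rw [hdiff, Set.injOn_insert fun h => he h.1]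
      refine ⟨R.injT.congr fun d hd => (hg'D d hd).symm, ?_⟩
      rintro ⟨d, hd, hdd⟩
      rw [hg'D d hd, hg'e] at hdd
      exact he₂ (Or.inr (R.image ▸ ⟨d, hd, hdd⟩))
    image := by
      rw [hdiff, Set.image_insert_eq, hg'e, ← R.image]
      congr 1
      exact Set.image_congr hg'D
    mapP := by
      rw [hA']
      rintro b (hb | ⟨v, hb⟩)
      · rw [hf'A b hb, R.mapP b hb]
      · rw [hf'e b ⟨v, hb⟩]
        exact (Prod.mk.inj (hqv (b, v) hb)).1
    mapT := by
      rw [hdiff]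
      rintro d (rfl | hd)
      · rw [hg'e, hT]
      · rw [hg'D d hd, R.mapT d hd]
    preFlow := by
      rw [hdiff]
      rintro d (rfl | hd)
      · rw [hg'e, hpref]
      · rw [hg'D d hd, R.preFlow d hd]
        refine Multiset.map_congr rfl fun bv hbv => ?_
        rw [hf'A _ (preConds_sdiff_subset hsub hC hcf ⟨d, hd, bv.2, hbv⟩)]
    postFlow := by
      rw [hdiff]
      rintro d (rfl | hd)
      · rw [hg'e, hpostf]
      · rw [hg'D d hd, R.postFlow d hd]
        refine Multiset.map_congr rfl fun bv hbv => ?_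
        rw [hf'A _ (Or.inr ⟨d, hd, bv.2, hbv⟩)]
    disjoint := by
      rw [Set.disjoint_insert_right]
      exact ⟨fun h => he₂ (Or.inl h), R.disjoint⟩
    finCfg := hunion ▸ hfin
    isInst := hunion ▸ hinst
    valOf := by
      rw [hA']
      rintro b (hb | ⟨v, hb⟩)
      · rw [hf'A b hb, valOf_setMode_of_notMem hO.uniqueInput _ _ (hfAe b hb), R.valOf b hb]
      · have hb₂ : (f' b, v) ∈ O.postFlow e₂ :=
          hpostf ▸ Multiset.mem_map_of_mem (fun bv => (f' bv.1, bv.2)) hb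
        rw [valOf_setMode_of_mem hO.uniqueInput _ _ hb₂, hO.uniqueInput.valOf_eq hb] }

/-- A configuration extending `C₁` is replayed after any configuration representing the same
marking as `C₁`. -/
theorem IsUnfolding.exists_replay {h : Hom O N} (hU : IsUnfolding h) (hN : N.Safe)
    {C₁ C₂ C : Set O.Trans} {ι₁ ι₂ : O.Assign} (hC₁ : O.Closed C₁) (hC : O.FinCfg C)
    (hι₁ : O.IsInst C ι₁) (hsub : C₁ ⊆ C) (hne : ∀ d ∈ C \ C₁, O.preFlow d ≠ 0)
    (hC₂ : O.FinCfg C₂) (hι₂ : O.IsInst C₂ ι₂) (hfin₁ : (O.cut C₁).Finite)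
    (hfin₂ : (O.cut C₂).Finite) (hM : mark h hfin₁ ι₁ = mark h hfin₂ ι₂) :
    ∃ ι₂ D₂ f g, Replay h C₁ C₂ C ι₁ ι₂ D₂ f g := by
  have hO := hU.1.isOccNet
  refine closed_induction (P := fun C => ∃ ι₂ D₂ f g, Replay h C₁ C₂ C ι₁ ι₂ D₂ f g) hO hC₁
    hC.1.closed hsub (hC.2.subset Set.sdiff_subset) ?_ ?_
  · obtain ⟨f, hf⟩ := exists_replay_self h hC₂ hι₂ hfin₁ hfin₂ hM
    exact ⟨ι₂, ∅, f, id, hf⟩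
  · rintro C' e hC' hsub' hins he hclosed ⟨ι₂, D₂, f, g, R⟩
    have heC : e ∈ C := hins (Set.mem_insert _ _)
    have hcf := hC.1.conflictFree.mono hins
    exact R.exists_insert hU hN hsub' hC' (hcf.mono (Set.subset_insert _ _)) he
      (pre_subset_cut he hclosed hcf hO) (((isInst_iff hC.1.closed).mp hι₁).2 e heC)
      (hne e ⟨heC, fun h => he (hsub' h)⟩)

theorem map_val_restrict {α β : Type} {S : Set α} (s : Multiset (α × β))
    (hs : ∀ x ∈ s, x.1 ∈ S) :
    (s.filterMap fun x => if h : x.1 ∈ S then some ((⟨x.1, h⟩ : ↥S), x.2) else none).map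
      (fun x => (x.1.1, x.2)) = s := by
  induction s using Multiset.induction_on with
  | empty => rfl
  | cons x s ih =>
    rw [Multiset.filterMap_cons_some _ (b := (⟨x.1, hs x (Multiset.mem_cons_self _ _)⟩, x.2)),
      Multiset.map_cons, ih fun y hy => hs y (Multiset.mem_cons_of_mem hy)]
    exact dif_pos _

theorem exists_leftInvOn {α : Type} {f : α → α} {A : Set α} (hf : Set.InjOn f A) :
    ∃ F : α → α, ∀ a ∈ A, F (f a) = a := by
  refine ⟨fun b => if h : ∃ a ∈ A, f a = b then h.choose else b, fun a ha => ?_⟩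
  have hex : ∃ a' ∈ A, f a' = f a := ⟨a, ha, rfl⟩
  simp only [dif_pos hex]
  exact hf hex.choose_spec.1 ha hex.choose_spec.2

/-- Restrictions of corresponding flows correspond. -/
theorem restrict_eq_map {α β : Type} {S T : Set α} {s t : Multiset (α × β)} {f F : α → α}
    (hs : ∀ x ∈ s, x.1 ∈ S) (ht : t = s.map fun x => (f x.1, x.2)) (htT : ∀ x ∈ t, x.1 ∈ T)
    (hF : ∀ x ∈ s, F (f x.1) = x.1) (Φ : ↥T → ↥S) (hΦ : ∀ x, (Φ x).1 = F x.1) :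
    (s.filterMap fun x => if h : x.1 ∈ S then some ((⟨x.1, h⟩ : ↥S), x.2) else none) =
      (t.filterMap fun x => if h : x.1 ∈ T then some ((⟨x.1, h⟩ : ↥T), x.2) else none).map
        fun x => (Φ x.1, x.2) := by
  have hinj : Function.Injective fun x : ↥S × β => (x.1.1, x.2) := by
    rintro ⟨a, b⟩ ⟨a', b'⟩ hab
    exact Prod.ext (Subtype.ext (Prod.mk.inj hab).1) (Prod.mk.inj hab).2
  apply Multiset.map_injective hinj
  rw [map_val_restrict s hs, Multiset.map_map]
  have := congrArg (Multiset.map fun x : α × β => (F x.1, x.2)) (map_val_restrict t htT)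
  rw [Multiset.map_map] at this
  refine Eq.trans ?_ (this.symm.trans ?_)
  · rw [ht, Multiset.map_map]
    conv_lhs => rw [← Multiset.map_id s]
    exact Multiset.map_congr rfl fun x hx => Prod.ext (hF x hx).symm rfl
  · exact Multiset.map_congr rfl fun x _ => Prod.ext (hΦ x.1).symm rfl

theorem IsOccNet.mem_futurePlaces (hO : O.IsOccNet) {C₁ C : Set O.Trans} (hC₁ : O.Closed C₁)
    (hC : O.IsConfig C) {ι : O.Assign} (hι : O.IsInst C ι) (hsub : C₁ ⊆ C) {b : O.Place}
    (hb : b ∈ O.cut C₁ ∪ O.postConds (C \ C₁)) : b ∈ O.futurePlaces C₁ := by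
  have hbC := cut_union_postConds_subset hsub hb
  refine ⟨?_, ?_, ι, hι.mono hsub, ?_⟩
  · rcases hb with hb | ⟨d, hd, hb⟩
    · exact hb.2
    · exact hC₁.notMem_preConds hd.2 hb
  · rintro e' he' ⟨p, t₁, t₂, hne, h₁, h₂, hle₁, hle₂⟩
    exact hne (hC.conflictFree.eq_of_mem_pre (hC.closed _ (hsub he') _ hle₁)
      (hC.closed.mem_of_cle hO.uniqueInput hbC hle₂) h₁ h₂)
  · show O.condPred b ι
    rcases hbC with hb | ⟨e, he, v, hb⟩
    · have : O.condPre b = none := hb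
      simp only [condPred, this]
      exact hι.1
    · simp only [condPred, hO.uniqueInput.condPre_eq hb]
      exact hι.2 e he

theorem mem_futureEvents {C₁ C : Set O.Trans} (hC : O.IsConfig C) {ι : O.Assign}
    (hι : O.IsInst C ι) (hsub : C₁ ⊆ C) {d : O.Trans} (hd : d ∈ C \ C₁) :
    d ∈ O.futureEvents C₁ :=
  ⟨hd.2, fun e' he' => hC.conflictFree e' (hsub he') d hd.1, ι, hι.mono hsub, hι.2 d hd.1⟩

/-- A replay induces a canonical monomorphism between the futures. -/
theorem Replay.exists_canonMono {h : Hom O N} (hO : O.IsOccNet) {C₁ C₂ C : Set O.Trans}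
    {ι₁ ι₂ : O.Assign} {D₂ : Set O.Trans} {f : O.Place → O.Place} {g : O.Trans → O.Trans}
    (R : Replay h C₁ C₂ C ι₁ ι₂ D₂ f g) (hC₁ : O.Closed C₁) (hC : O.IsConfig C)
    (hι₁ : O.IsInst C ι₁) (hsub : C₁ ⊆ C) :
    ∃ φ : Hom (O.around C₂ D₂) (O.future C₁), IsCanonMono h C₂ D₂ C₁ φ ∧
      monoImageD C₂ D₂ C₁ φ = C \ C₁ := by
  obtain ⟨F, hF⟩ := exists_leftInvOn R.injP
  obtain ⟨G, hG⟩ := exists_leftInvOn R.injT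
  set A := O.cut C₁ ∪ O.postConds (C \ C₁) with hA
  have hpreA : ∀ d ∈ C \ C₁, ∀ bv ∈ O.preFlow d, bv.1 ∈ A := fun d hd bv hbv =>
    preConds_sdiff_subset hsub hC.closed hC.conflictFree ⟨d, hd, bv.2, hbv⟩
  have hpostA : ∀ d ∈ C \ C₁, ∀ bv ∈ O.postFlow d, bv.1 ∈ A := fun d hd bv hbv =>
    Or.inr ⟨d, hd, bv.2, hbv⟩
  have hD : ∀ d₂ ∈ D₂, ∃ d ∈ C \ C₁, g d = d₂ := fun d₂ hd₂ => by
    rw [← R.image] at hd₂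
    exact hd₂
  have hP : ∀ b ∈ O.aroundPlaces C₂ D₂, ∃ a ∈ A, f a = b := by
    rintro b ((hb | ⟨d₂, hd₂, v, hb⟩) | ⟨d₂, hd₂, v, hb⟩)
    · rw [← R.image_cut] at hb
      obtain ⟨a, ha, rfl⟩ := hb
      exact ⟨a, Or.inl ha, rfl⟩
    · obtain ⟨d, hd, rfl⟩ := hD d₂ hd₂
      rw [R.preFlow d hd] at hb
      obtain ⟨bv, hbv, heq⟩ := Multiset.mem_map.mp hb
      exact ⟨bv.1, hpreA d hd bv hbv, (Prod.mk.inj heq).1⟩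
    · obtain ⟨d, hd, rfl⟩ := hD d₂ hd₂
      rw [R.postFlow d hd] at hb
      obtain ⟨bv, hbv, heq⟩ := Multiset.mem_map.mp hb
      exact ⟨bv.1, hpostA d hd bv hbv, (Prod.mk.inj heq).1⟩
  have hfut : ∀ b ∈ A, b ∈ O.futurePlaces C₁ := fun b hb =>
    hO.mem_futurePlaces hC₁ hC hι₁ hsub hb
  have hFP : ∀ b ∈ O.aroundPlaces C₂ D₂, F b ∈ A := by
    intro b hb
    obtain ⟨a, ha, rfl⟩ := hP b hb
    rwa [hF a ha]
  have hGD : ∀ d ∈ D₂, G d ∈ C \ C₁ := by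
    intro d₂ hd₂
    obtain ⟨d, hd, rfl⟩ := hD d₂ hd₂
    rwa [hG d hd]
  have hgG : ∀ d ∈ D₂, g (G d) = d := by
    intro d₂ hd₂
    obtain ⟨d, hd, rfl⟩ := hD d₂ hd₂
    rw [hG d hd]
  have hfF : ∀ b ∈ O.aroundPlaces C₂ D₂, f (F b) = b := by
    intro b hb
    obtain ⟨a, ha, rfl⟩ := hP b hb
    rw [hF a ha]
  let ΦP : ↥(O.aroundPlaces C₂ D₂) → ↥(O.futurePlaces C₁) := fun b => ⟨F b.1, hfut _ (hFP b.1 b.2)⟩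
  let ΦT : ↥D₂ → ↥(O.futureEvents C₁) := fun d =>
    ⟨G d.1, mem_futureEvents hC hι₁ hsub (hGD d.1 d.2)⟩
  have hmapT : ∀ d : ↥D₂, h.mapT (G d.1) = h.mapT d.1 := fun d => by
    conv_rhs => rw [← hgG d.1 d.2]
    exact (R.mapT _ (hGD d.1 d.2)).symm
  let φ : Hom (O.around C₂ D₂) (O.future C₁) :=
    { mapP := ΦP
      mapT := ΦT
      guard_iff := fun d σ => by
        show O.guard d.1 σ ↔ O.guard (G d.1) σ
        rw [h.guard_iff, h.guard_iff, hmapT d]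
      pre_eq := fun d => by
        have hd := hGD d.1 d.2
        refine restrict_eq_map (f := f) (F := F) (fun bv hbv => hfut _ (hpreA _ hd bv hbv)) ?_
          (fun bv hbv => Or.inl (Or.inr ⟨d.1, d.2, bv.2, hbv⟩))
          (fun bv hbv => hF _ (hpreA _ hd bv hbv)) ΦP fun _ => rfl
        rw [← R.preFlow _ hd, hgG d.1 d.2]
      post_eq := fun d => by
        have hd := hGD d.1 d.2
        refine restrict_eq_map (f := f) (F := F) (fun bv hbv => hfut _ (hpostA _ hd bv hbv)) ?_
          (fun bv hbv => Or.inr ⟨d.1, d.2, bv.2, hbv⟩)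
          (fun bv hbv => hF _ (hpostA _ hd bv hbv)) ΦP fun _ => rfl
        rw [← R.postFlow _ hd, hgG d.1 d.2] }
  refine ⟨φ, ⟨?_, ?_, ?_, hmapT, ?_⟩, ?_⟩
  · rintro ⟨b, hb⟩ ⟨b', hb'⟩ hbb
    have : F b = F b' := congrArg Subtype.val hbb
    exact Subtype.ext ((hfF b hb).symm.trans ((congrArg f this).trans (hfF b' hb')))
  · rintro ⟨d, hd⟩ ⟨d', hd'⟩ hdd
    have : G d = G d' := congrArg Subtype.val hdd
    exact Subtype.ext ((hgG d hd).symm.trans ((congrArg g this).trans (hgG d' hd')))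
  · rintro ⟨b, hb⟩
    show h.mapP (F b) = h.mapP b
    rw [← R.mapP _ (hFP b hb), hfF b hb]
  · ext a
    constructor
    · rintro ⟨⟨b, hb⟩, hbc, rfl⟩
      have hbc' : b ∈ O.cut C₂ := hbc
      rw [← R.image_cut] at hbc'
      obtain ⟨a, ha, rfl⟩ := hbc'
      show F (f a) ∈ _
      rwa [hF a (Or.inl ha)]
    · intro ha
      have hfa : f a ∈ O.cut C₂ := R.image_cut ▸ Set.mem_image_of_mem f ha
      exact ⟨⟨f a, Or.inl (Or.inl hfa)⟩, hfa, hF a (Or.inl ha)⟩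
  · ext d
    constructor
    · rintro ⟨d₂, rfl⟩
      exact hGD d₂.1 d₂.2
    · intro hd
      exact ⟨⟨g d, R.image ▸ Set.mem_image_of_mem g hd⟩, hG d hd⟩

/-- A configuration containing a cone whose marking is represented by a smaller configuration is
not minimal among the configurations representing its marking. -/
theorem IsUnfolding.exists_smaller {h : Hom O N} (hU : IsUnfolding h) (hN : N.Safe)
    {r : Set O.Trans → Set O.Trans → Prop} (hr : IsAdequate h r) {C₁ C₂ C : Set O.Trans}
    {ι₁ : O.Assign} (hC₁ : O.Closed C₁) (hC : O.FinCfg C) (hι₁ : O.IsInst C ι₁)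
    (hsub : C₁ ⊆ C) (hne : ∀ d ∈ C, O.preFlow d ≠ 0) (hC₂ : O.FinCfg C₂)
    (hfin₁ : (O.cut C₁).Finite) (hM : mark h hfin₁ ι₁ ∈ marks h C₂) (hlt : r C₂ C₁)
    (hfin : (O.cut C).Finite) : ∃ C', O.FinCfg C' ∧ r C' C ∧ mark h hfin ι₁ ∈ marks h C' := by
  have hO := hU.1.isOccNet
  obtain ⟨ι₀, hι₀, hfin₂, hM₀⟩ := hM
  obtain ⟨ι₂, D₂, f, g, R⟩ := hU.exists_replay hN hC₁ hC hι₁ hsub (fun d hd => hne d hd.1) hC₂ hι₀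
    hfin₁ hfin₂ hM₀
  obtain ⟨φ, hφ, himage⟩ := R.exists_canonMono hO hC₁ hC.1 hι₁ hsub
  have hC₁' := finCfg_of_subset hC hsub hC₁
  have hmark : mark h hfin₁ ι₁ = mark h hfin₂ ι₂ :=
    mark_eq_of_image h (R.injP.mono Set.subset_union_left) R.image_cut
      (fun b hb => R.mapP b (Or.inl hb)) (fun b hb => R.valOf b (Or.inl hb)) _ _
  have hrel := hr.2.2.2.2 C₂ C₁ D₂ (mark h hfin₁ ι₁) hC₂ hC₁' ⟨R.disjoint, R.finCfg.1⟩
    (R.finCfg.2.subset Set.subset_union_right) ⟨ι₀, hι₀, hfin₂, hM₀⟩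
    ⟨ι₁, hι₁.mono hsub, hfin₁, rfl⟩ ⟨ι₂, R.isInst, hfin₂, hmark.symm⟩ φ hφ hlt
  rw [himage, Set.union_sdiff_cancel hsub] at hrel
  have hcut := cut_subset_cut_union_postConds (O := O) hsub
  exact ⟨C₂ ∪ D₂, R.finCfg, hrel, ι₂, R.isInst, hO.cut_finite R.finCfg.2,
    mark_eq_of_image h (R.injP.mono hcut) R.image_cut' (fun b hb => R.mapP b (hcut hb))
      (fun b hb => R.valOf b (hcut hb)) _ _⟩

/-- An event with empty preset is redundant. -/
theorem IsUnfolding.exists_smaller_of_preFlow_eq_zero {h : Hom O N} (hU : IsUnfolding h)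
    (hN : N.Safe) {C : Set O.Trans} (hC : O.FinCfg C) {M : N.Marking} (hM : M ∈ marks h C)
    {d : O.Trans} (hd : d ∈ C) (h₀ : O.preFlow d = 0) :
    O.FinCfg (C \ {d}) ∧ (C \ {d}).ncard < C.ncard ∧ M ∈ marks h (C \ {d}) := by
  have hO := hU.1.isOccNet
  have hpost := hU.1.post_eq_empty hN h₀
  have hcl : O.Closed (C \ {d}) := by
    rintro e he e' hle
    refine ⟨hC.1.closed e he.1 e' hle, ?_⟩
    rintro rfl
    rcases eq_or_cle_pre_of_evLE hle with rfl | ⟨b, hb, hcle⟩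
    · exact he.2 rfl
    · rcases Relation.ReflTransGen.cases_head hcle with h | ⟨c, hc, -⟩
      · cases h
      · rcases c with c | c
        · exact (Set.eq_empty_iff_forall_notMem.mp hpost c) hc
        · exact hc
  have hC' := finCfg_of_subset hC Set.sdiff_subset hcl
  have hpre : O.pre d = ∅ := by
    ext b
    simp [pre, h₀]
  have hcut : O.cut (C \ {d}) = O.cut C := by
    have := cut_insert hO hcl (e := d) (by simp)
    rw [Set.insert_sdiff_singleton, Set.insert_eq_of_mem hd, hpre, hpost] at this
    simpa using this.symm
  refine ⟨hC', Set.ncard_sdiff_singleton_lt_of_mem hd hC.2, ?_⟩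
  obtain ⟨ι, hι, hfin, rfl⟩ := hM
  exact ⟨ι, hι.mono Set.sdiff_subset, hcut ▸ hfin, mark_congr h hcut.symm _ _ fun _ _ => rfl⟩

/-- The events of the truncated unfolding form a complete prefix. -/
theorem IsUnfolding.completeSub {h : Hom O N} (hU : IsUnfolding h) (hN : N.Safe) {n : ℕ}
    (hn : N.BoundedReach n) {r : Set O.Trans → Set O.Trans → Prop} (hr : IsAdequate h r)
    (hsz : ∀ C1 C2, O.FinCfg C1 → O.FinCfg C2 → C1.ncard < C2.ncard → r C1 C2) :
    CompleteSub h (finEventsStar h r) := by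
  have hO := hU.1.isOccNet
  intro M hM
  obtain ⟨k, -, hk⟩ := hn M hM
  obtain ⟨C₀, hC₀, -, hMC₀⟩ := hU.exists_finCfg_of_reachSteps hN hk
  obtain ⟨⟨C, hC⟩, hMC, hmin⟩ := hr.2.2.1.has_min
    {C : {C : Set O.Trans // O.FinCfg C} | M ∈ marks h C.1} ⟨⟨C₀, hC₀⟩, hMC₀⟩
  have hmin' : ∀ C', O.FinCfg C' → M ∈ marks h C' → ¬ r C' C := fun C' hC' hM' =>
    hmin ⟨C', hC'⟩ hM'
  have hMC' : M ∈ marks h C := hMC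
  have hne : ∀ d ∈ C, O.preFlow d ≠ 0 := fun d hd h₀ => by
    obtain ⟨h₁, h₂, h₃⟩ := hU.exists_smaller_of_preFlow_eq_zero hN hC hMC' hd h₀
    exact hmin' _ h₁ h₃ (hsz _ _ h₁ hC h₂)
  obtain ⟨ι, hι, hfin, rfl⟩ := hMC'
  have hcut : ∀ e ∈ C, ¬ IsCutoffStar h r e := by
    intro e he hcutoff
    have hsub := cone_subset hC.1.closed he
    have hfin₁ := hO.cut_finite (hO.cone_finite e)
    obtain ⟨C₂, hC₂, hlt, hM₂⟩ := hcutoff (mark h hfin₁ ι) ⟨ι, hι.mono hsub, hfin₁, rfl⟩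
    obtain ⟨C', hC', hlt', hM'⟩ := hU.exists_smaller hN hr (closed_cone e) hC hι hsub hne hC₂ hfin₁
      hM₂ hlt hfin
    exact hmin' C' hC' hM' hlt'
  refine ⟨C, hC.1, fun e he e' he' _ => hcut e' (hC.1.closed e he e' he'), ι, hι, hfin, rfl, ?_⟩
  intro t σ hf
  obtain ⟨e, rfl, hpre, hval⟩ := hU.exists_event_of_fires hN hC hι hfin hf
  refine ⟨e, fun e' he' hne' => hcut e' ?_, rfl, (h.guard_iff e σ).mpr hf.1, ?_⟩
  · rcases eq_or_cle_pre_of_evLE he' with rfl | ⟨b, hb, hle⟩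
    · exact (hne' rfl).elim
    · exact hC.1.closed.mem_of_cle hO.uniqueInput (hpre hb).1 hle
  · have heq : O.preMark e σ = ((O.preFlow e).map Prod.fst).map fun b => (b, O.valOf ι b) := by
      rw [preMark, Multiset.map_map]
      exact Multiset.map_congr rfl fun bv hbv => Prod.ext rfl (hval bv hbv)
    rw [heq]
    exact Multiset.map_le_map (map_fst_preFlow_le_cut hO hpre hfin)

end HLNet

/-- Let `N` be a symbolically compact high-level Petri net
(`N ∈ Nsc`) and let `≺` be an adequate order on the finite configurations of its
symbolic unfolding `Υ = (O, h)` satisfying `|C1| < |C2| ⇒ C1 ≺ C2`. Let `Fin` be the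
prefix of `Υ` consisting of all events `e` such that the cone `[e]` contains no
cut-off* event of `Υ` other than possibly `e` itself, together with all conditions in
`B0` and in the postsets of these events. Then `Fin` is a finite and complete prefix
of `Υ(N)`. -/
theorem fin_star_prefix_is_finite_and_complete {Color Var : Type}
    (N O : HLNet Color Var) (h : HLNet.Hom O N)
    (hNsc : N.InNsc) (hU : HLNet.IsUnfolding h)
    (r : Set O.Trans → Set O.Trans → Prop) (hr : HLNet.IsAdequate h r)
    (hsz : ∀ C1 C2, O.FinCfg C1 → O.FinCfg C2 → C1.ncard < C2.ncard → r C1 C2) :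
    (HLNet.finEventsStar h r).Finite ∧ (HLNet.finCondsStar h r).Finite ∧
      HLNet.CompleteSub h (HLNet.finEventsStar h r) := by
  obtain ⟨hfin, -, hsafe, -, n, hn⟩ := hNsc
  have hE := hU.finEventsStar_finite hsafe hfin hn hsz
  exact ⟨hE, hU.1.isOccNet.B0_finite.union (HLNet.postConds_finite hE),
    hU.completeSub hsafe hn hr hsz⟩
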